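/- Let q be an odd prime power, d ≥ 2, and let Q be a non-degenerate quadratic form on F_q^d, with associated distance φ(x,y) = Q(x−y). Let E ⊆ F_q^d, let k ≥ 1, and fix nonzero elements t_1, …, t_k ∈ F_q \ {0}. Let P_k denote the number of (k+1)-tuples (x_0, x_1, …, x_k) ∈ E^{k+1} with φ(x_{i−1}, x_i) = t_i for all 1 ≤ i ≤ k. If |E| > (2k/ln 2) q^{(d+1)/2}, then | P_k − |E|^{k+1}/q^k | ≤ (2k/ln 2) q^{(d+1)/2} · |E|^k / q^k. -/

import Mathlib

open Finset


open Polynomial in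
lemma stp_sum_ne_zero {K ι : Type*} [Field K] [Fintype ι] (g : ι → K[X]) (e : ι → ℕ)
    (he : Function.Injective e) (hg : ∀ i, (g i).natDegree = e i) (hg0 : ∀ i, g i ≠ 0)
    (s : ι → K) (hs : s ≠ 0) : ∑ i, C (s i) * g i ≠ 0 := by
  classical
  have hne : (univ.filter (fun i => s i ≠ 0)).Nonempty := by
    obtain ⟨i, hi⟩ := Function.ne_iff.mp hs
    exact ⟨i, by simpa using hi⟩
  obtain ⟨i, hi, hmax⟩ := exists_max_image _ e hne
  simp only [mem_filter, mem_univ, true_and] at hi hmax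
  intro h0
  have h1 : (∑ i, C (s i) * g i).coeff (e i) = s i * (g i).leadingCoeff := by
    rw [finsetSum_coeff, Finset.sum_eq_single i]
    · rw [coeff_C_mul, leadingCoeff, hg]
    · intro j _ hj
      rw [coeff_C_mul]
      by_cases hsj : s j = 0
      · simp [hsj]
      · rw [coeff_eq_zero_of_natDegree_lt, mul_zero]
        rw [hg]
        exact lt_of_le_of_ne (hmax j hsj) (fun h => hj (he h))
    · simp
  rw [h0, coeff_zero] at h1
  exact (mul_ne_zero hi (leadingCoeff_ne_zero.mpr (hg0 i))) h1.symm

open Polynomial in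
lemma stp_exists_rel {K ι : Type*} [Field K] [Fintype ι] (h : ι → K[X]) (D : ℕ)
    (hD : ∀ i, (h i).natDegree < D) (hcard : D < Fintype.card ι) :
    ∃ r : ι → K, r ≠ 0 ∧ ∑ i, C (r i) * h i = 0 := by
  classical
  let T : (ι → K) →ₗ[K] (Fin D → K) :=
    { toFun := fun r n => (∑ i, C (r i) * h i).coeff n
      map_add' := by
        intro r s; ext n
        simp [finsetSum_coeff, add_mul, Finset.sum_add_distrib]
      map_smul' := by
        intro r s; ext n
        simp [finsetSum_coeff, mul_assoc, Finset.mul_sum] }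
  have hker : LinearMap.ker T ≠ ⊥ := LinearMap.ker_ne_bot_of_finrank_lt (by simpa using hcard)
  obtain ⟨r, hr, hr0⟩ := Submodule.exists_mem_ne_zero_of_ne_bot hker
  refine ⟨r, hr0, ?_⟩
  ext n
  rw [coeff_zero]
  by_cases hn : n < D
  · exact congrFun (LinearMap.mem_ker.mp hr) ⟨n, hn⟩
  · rw [finsetSum_coeff]
    refine Finset.sum_eq_zero fun i _ => ?_
    rw [coeff_C_mul, coeff_eq_zero_of_natDegree_lt, mul_zero]
    have := hD i
    omega

open Polynomial in
lemma stp_core {K : Type*} [Field K] [Fintype K] [DecidableEq K] (q L R : ℕ) (hq : 3 ≤ q)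
    (hL : 1 ≤ L) (hR : R = q * L) (hcard : Fintype.card K = R ^ 2)
    (φ : K →+* K) (hφ : ∀ x, φ x = x ^ R) (V : K[X]) (hV : V.natDegree = 2 * L) (c : K)
    (Z : Finset K) (hZ : ∀ x ∈ Z, x ≠ 0 ∧ ∃ U : K, V.eval x = x ^ L * U ∧ U ^ R = c - U) :
    Z.card ≤ L * R + 3 * R := by
  have hV0 : V ≠ 0 := by
    rintro rfl
    simp at hV; omega
  -- indices (i, j, k)
  let ι := Fin (L + 2) × Fin q × Fin L
  let g : ι → K[X] := fun t => X ^ (t.2.2.1 + t.1.1 * R + L * (q - 1 - t.2.1.1)) * V ^ t.2.1.1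
  let h : ι → K[X] := fun t => X ^ (t.2.2.1 * R + t.1.1 + L * (q - 1 - t.2.1.1)) *
    (C c * X ^ L - V) ^ t.2.1.1
  have hgdeg : ∀ t, (g t).natDegree = (q - 1) * L + t.1.1 * R + t.2.1.1 * L + t.2.2.1 := by
    rintro ⟨i, j, k⟩
    simp only [g]
    rw [natDegree_mul (pow_ne_zero _ X_ne_zero) (pow_ne_zero _ hV0), natDegree_pow, natDegree_pow,
      natDegree_X, hV]
    have hj := j.2
    obtain ⟨w, hw⟩ : ∃ w, q = j.1 + 1 + w := ⟨q - (j.1 + 1), by omega⟩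
    have e1 : q - 1 - j.1 = w := by omega
    have e2 : q - 1 = j.1 + w := by omega
    rw [e1, e2]; ring
  have hg0 : ∀ t, g t ≠ 0 := fun t => mul_ne_zero (pow_ne_zero _ X_ne_zero) (pow_ne_zero _ hV0)
  have hinj : Function.Injective
      (fun t : ι => (q - 1) * L + t.1.1 * R + t.2.1.1 * L + t.2.2.1) := by
    rintro ⟨i, j, k⟩ ⟨i', j', k'⟩ hh
    simp only at hh
    have hh' : L * (q * i.1 + j.1) + k.1 = L * (q * i'.1 + j'.1) + k'.1 := by
      subst hR; linarith [hh]
    have hk : k.1 = k'.1 := by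
      have := congrArg (· % L) hh'
      simpa [Nat.mul_add_mod, Nat.mod_eq_of_lt k.2, Nat.mod_eq_of_lt k'.2] using this
    have h2 : q * i.1 + j.1 = q * i'.1 + j'.1 := by
      have : L * (q * i.1 + j.1) = L * (q * i'.1 + j'.1) := by omega
      exact Nat.eq_of_mul_eq_mul_left hL this
    have hj : j.1 = j'.1 := by
      have := congrArg (· % q) h2
      simpa [Nat.mul_add_mod, Nat.mod_eq_of_lt j.2, Nat.mod_eq_of_lt j'.2] using this
    have hi : i.1 = i'.1 := by
      have : q * i.1 = q * i'.1 := by omega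
      exact Nat.eq_of_mul_eq_mul_left (by omega) this
    ext <;> simp [hi, hj, hk]
  have hhdeg : ∀ t, (h t).natDegree < (L - 1) * R + (L + 2) + 2 * L * (q - 1) := by
    rintro ⟨i, j, k⟩
    simp only [h]
    refine lt_of_le_of_lt natDegree_mul_le ?_
    have h1 : (C c * X ^ L - V).natDegree ≤ 2 * L := by
      refine (natDegree_sub_le _ _).trans (max_le ?_ hV.le)
      exact (natDegree_C_mul_X_pow_le _ _).trans (by omega)
    have h2 : ((C c * X ^ L - V) ^ j.1).natDegree ≤ j.1 * (2 * L) :=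
      natDegree_pow_le.trans (Nat.mul_le_mul_left _ h1)
    rw [natDegree_X_pow]
    have hj := j.2
    obtain ⟨w, hw⟩ : ∃ w, q = j.1 + 1 + w := ⟨q - (j.1 + 1), by omega⟩
    have e1 : q - 1 - j.1 = w := by omega
    have e2 : q - 1 = j.1 + w := by omega
    have h3 : k.1 * R ≤ (L - 1) * R := Nat.mul_le_mul_right _ (by have := k.2; omega)
    have hi := i.2
    rw [e1, e2]
    have h4 : 2 * L * (j.1 + w) = L * w + j.1 * (2 * L) + L * w := by ring
    have h5 : 0 ≤ L * w := Nat.zero_le _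
    omega
  have hcardι : (L - 1) * R + (L + 2) + 2 * L * (q - 1) < Fintype.card ι := by
    simp only [ι, Fintype.card_prod, Fintype.card_fin]
    obtain ⟨l, rfl⟩ : ∃ l, L = l + 1 := ⟨L - 1, by omega⟩
    obtain ⟨w, rfl⟩ : ∃ w, q = w + 3 := ⟨q - 3, by omega⟩
    have e1 : l + 1 - 1 = l := by omega
    have e2 : w + 3 - 1 = w + 2 := by omega
    rw [e1, e2, hR]
    nlinarith [Nat.zero_le (l * w)]
  obtain ⟨r, hr0, hr⟩ := stp_exists_rel h _ hhdeg hcardι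
  have hR2 : ∀ x : K, (x ^ R) ^ R = x := by
    intro x
    rw [← pow_mul, ← sq, ← hcard, FiniteField.pow_card]
  let s : ι → K := fun t => r t ^ R
  have hs0 : s ≠ 0 := by
    intro hs
    apply hr0
    ext t
    have : s t = 0 := congrFun hs t
    rw [← hR2 (r t)]
    simp only [s] at this
    rw [this, Pi.zero_apply, zero_pow]
    subst hR
    positivity
  set G := ∑ t, C (s t) * g t with hG
  have hGne : G ≠ 0 := stp_sum_ne_zero g _ hinj hgdeg hg0 s hs0
  have hXdvd : ∀ x ∈ Z, G.eval x = 0 := by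
    intro x hx
    obtain ⟨hx0, U, hU1, hU2⟩ := hZ x hx
    have key : x ^ (L * (q - 1)) * φ (G.eval x) = x ^ (L * R * (q - 1)) *
        (∑ t, C (r t) * h t).eval x := by
      rw [hG, eval_finsetSum, eval_finsetSum, map_sum, Finset.mul_sum, Finset.mul_sum]
      refine Finset.sum_congr rfl ?_
      rintro ⟨i, j, k⟩ -
      have hj := j.2
      obtain ⟨w, hw⟩ : ∃ w, q = j.1 + 1 + w := ⟨q - (j.1 + 1), by omega⟩
      have e1 : q - 1 - j.1 = w := by omega
      have e2 : q - 1 = j.1 + w := by omega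
      simp only [g, h, s, eval_mul, eval_C, eval_pow, eval_X, eval_sub, hφ, e1, hU1]
      rw [e2, mul_pow (r (i, j, k) ^ R), hR2]
      have hxi : x ^ (i.1 * R * R) = x ^ i.1 := by rw [pow_mul, pow_mul, hR2]
      calc _ = x ^ (L * (j.1 + w)) * (r (i, j, k) * (x ^ (k.1 * R) * x ^ (i.1 * R * R) *
              x ^ (L * w * R) * x ^ (L * j.1 * R) * (U ^ R) ^ j.1)) := by ring
        _ = x ^ (L * R * (j.1 + w)) * (r (i, j, k) * (x ^ (k.1 * R + i.1 + L * w) *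
              (x ^ L * (c - U)) ^ j.1)) := by rw [hxi, hU2, mul_pow]; ring
        _ = _ := by congr 4; ring
    rw [hr, eval_zero, mul_zero, hφ] at key
    have := (mul_eq_zero.mp key).resolve_left (pow_ne_zero _ hx0)
    exact eq_zero_of_pow_eq_zero this
  have hGdeg : G.natDegree ≤ L * R + 3 * R := by
    rw [hG]
    refine natDegree_sum_le_of_forall_le _ _ ?_
    rintro ⟨i, j, k⟩ -
    refine (natDegree_C_mul_le _ _).trans ?_
    rw [hgdeg]
    simp only
    have hi : i.1 * R ≤ (L + 1) * R := Nat.mul_le_mul_right _ (by have := i.2; omega)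
    have hj : j.1 * L ≤ (q - 1) * L := Nat.mul_le_mul_right _ (by have := j.2; omega)
    have hk := k.2
    have h1 : (q - 1) * L + L = R := by
      rw [hR]
      obtain ⟨w, rfl⟩ : ∃ w, q = w + 1 := ⟨q - 1, by omega⟩
      simp; ring
    have h2 : (L + 1) * R = L * R + R := by ring
    omega
  calc Z.card ≤ G.roots.toFinset.card := by
        apply Finset.card_le_card
        intro x hx
        simp [hGne, hXdvd x hx]
    _ ≤ G.roots.card := Multiset.toFinset_card_le _
    _ ≤ G.natDegree := card_roots' _
    _ ≤ _ := hGdeg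


open Polynomial in
/-- Stepanov bound. -/
lemma stepanov {F K : Type*} [Field F] [Fintype F] [Field K] [Fintype K] [DecidableEq F]
    [DecidableEq K] [Algebra F K] (q m : ℕ) (hq : Fintype.card F = q) (hq3 : 3 ≤ q) (hm : 1 ≤ m)
    (hK : Module.finrank F K = 2 * m) (a b : F) (ha : a ≠ 0) (c : F) :
    (univ.filter (fun x : K => x ≠ 0 ∧
      Algebra.trace F K (algebraMap F K a * x + algebraMap F K b * x⁻¹) = c)).card
      ≤ q ^ (2 * m - 1) + 3 * q ^ m := by
  obtain ⟨l, rfl⟩ : ∃ l, m = l + 1 := ⟨m - 1, by omega⟩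
  set A := algebraMap F K a with hA
  set B := algebraMap F K b with hB
  have hA0 : A ≠ 0 := by simpa [hA] using ha
  -- Frobenius powers
  let fr : ℕ → (K →+* K) := fun i => ((FiniteField.frobeniusAlgHom F K) ^ i).toRingHom
  have hfr : ∀ i x, fr i x = x ^ (q ^ i) := by
    intro i x
    change ((FiniteField.frobeniusAlgHom F K) ^ i) x = _
    rw [AlgHom.coe_pow, FiniteField.coe_frobeniusAlgHom, pow_iterate, hq]
  have hfrF : ∀ i (y : F), (algebraMap F K y) ^ (q ^ i) = algebraMap F K y := by
    intro i y
    rw [← hfr]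
    exact AlgHom.commutes _ y
  let V : K[X] := ∑ i ∈ range (l + 1), (C A * X ^ (q ^ l + q ^ i) + C B * X ^ (q ^ l - q ^ i))
  have hqpos : 0 < q := by omega
  have hqi : ∀ i ∈ range (l + 1), q ^ i ≤ q ^ l := by
    intro i hi
    exact Nat.pow_le_pow_right hqpos (by simpa [Nat.lt_succ_iff] using hi)
  have hVle : V.natDegree ≤ 2 * q ^ l := by
    refine natDegree_sum_le_of_forall_le _ _ ?_
    intro i hi
    have := hqi i hi
    refine natDegree_add_le_of_degree_le ?_ ?_
    · exact (natDegree_C_mul_X_pow_le _ _).trans (by omega)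
    · exact (natDegree_C_mul_X_pow_le _ _).trans (by omega)
  have hVc : V.coeff (2 * q ^ l) = A := by
    simp only [V]
    rw [finsetSum_coeff, Finset.sum_eq_single l]
    · have h1 : 0 < q ^ l := by positivity
      simp [coeff_X_pow, two_mul]
      exact coeff_C_of_ne_zero (by omega)
    · intro i hi hil
      have h1 : q ^ i < q ^ l := Nat.pow_lt_pow_right (by omega) (by
        have := mem_range.mp hi; omega)
      have h2 : 2 * q ^ l ≠ q ^ l + q ^ i := by omega
      have h3 : 2 * q ^ l ≠ q ^ l - q ^ i := by omega
      simp [coeff_X_pow, h2, h3]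
    · simp
  have hV : V.natDegree = 2 * q ^ l :=
    le_antisymm hVle (le_natDegree_of_ne_zero (by rw [hVc]; exact hA0))
  have hmain := stp_core (K := K) q (q ^ l) (q ^ (l + 1)) hq3 (Nat.one_le_pow _ _ hqpos)
    (by ring) (by
      rw [Module.card_eq_pow_finrank (K := F), hq, hK]; ring) (fr (l + 1)) (hfr (l + 1)) V hV
    (algebraMap F K c) (univ.filter (fun x : K => x ≠ 0 ∧
      Algebra.trace F K (A * x + B * x⁻¹) = c)) (by
      intro x hx
      simp only [mem_filter, mem_univ, true_and] at hx
      obtain ⟨hx0, hx1⟩ := hx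
      refine ⟨hx0, ∑ i ∈ range (l + 1), (A * x + B * x⁻¹) ^ (q ^ i), ?_, ?_⟩
      · simp only [V]
        rw [eval_finsetSum, Finset.mul_sum]
        refine Finset.sum_congr rfl fun i hi => ?_
        have h1 : (A * x + B * x⁻¹) ^ (q ^ i) = A * x ^ (q ^ i) + B * (x ^ (q ^ i))⁻¹ := by
          rw [← hfr, map_add, map_mul, map_mul, hfr, hfr, hfr, hfr, hA, hB, hfrF, hfrF, inv_pow]
        rw [h1]
        have h2 := hqi i hi
        simp only [eval_add, eval_mul, eval_C, eval_pow, eval_X]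
        rw [pow_sub₀ _ hx0 h2, pow_add]
        ring
      · have h3 := FiniteField.algebraMap_trace_eq_sum_pow F K (A * x + B * x⁻¹)
        rw [hx1, hK, Nat.card_eq_fintype_card, hq, two_mul, Finset.sum_range_add] at h3
        rw [h3, add_sub_cancel_left, ← hfr, map_sum]
        refine Finset.sum_congr rfl fun i hi => ?_
        rw [hfr, ← pow_mul, ← pow_add, add_comm i])
  refine hmain.trans (le_of_eq ?_)
  have : 2 * (l + 1) - 1 = l + (l + 1) := by omega
  rw [this, pow_add q l (l + 1)]


noncomputable section LfunSection

open Polynomial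

/-- polynomial with given lower coefficients -/
def monOf {F : Type*} [Field F] (n : ℕ) (c : Fin n → F) : F[X] :=
  X ^ n + ∑ i : Fin n, C (c i) * X ^ (i : ℕ)

lemma monOf_monic {F : Type*} [Field F] (n : ℕ) (c : Fin n → F) :
    (monOf n c).Monic ∧ (monOf n c).natDegree = n := by
  have h := degree_sum_fin_lt c
  refine ⟨monic_X_pow_add h, ?_⟩
  rw [monOf, natDegree_add_eq_left_of_degree_lt, natDegree_X_pow]
  rwa [degree_X_pow]

lemma monOf_coeff {F : Type*} [Field F] (n : ℕ) (c : Fin n → F) (i : Fin n) :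
    (monOf n c).coeff i = c i := by
  classical
  rw [monOf, coeff_add, coeff_X_pow, if_neg i.2.ne, zero_add, finsetSum_coeff,
    Finset.sum_eq_single i]
  · simp
  · intro j _ hj
    rw [coeff_C_mul_X_pow, if_neg]
    exact fun h => hj (Fin.ext h.symm)
  · simp

lemma monOf_inj {F : Type*} [Field F] (n : ℕ) :
    Function.Injective (monOf (F := F) n) := by
  intro c c' h
  ext i
  rw [← monOf_coeff n c, h, monOf_coeff]

/-- monic polynomials of degree n -/
def mon (F : Type*) [Field F] [Fintype F] (n : ℕ) : Finset F[X] :=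
  univ.map ⟨monOf n, monOf_inj n⟩

lemma mem_mon {F : Type*} [Field F] [Fintype F] {n : ℕ} {g : F[X]} :
    g ∈ mon F n ↔ g.Monic ∧ g.natDegree = n := by
  simp only [mon, Finset.mem_map, mem_univ, true_and, Function.Embedding.coeFn_mk]
  constructor
  · rintro ⟨c, rfl⟩
    exact monOf_monic n c
  · rintro ⟨hg, hn⟩
    refine ⟨fun i => g.coeff i, ?_⟩
    conv_rhs => rw [hg.as_sum]
    rw [monOf, hn, Finset.sum_range]

open Classical in
lemma card_pow_dvd {F : Type*} [Field F] [Fintype F] {n : ℕ} {g P : F[X]} (hg : g ∈ mon F n)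
    (hP : P.Monic) (hPi : Irreducible P) :
    ((Icc 1 n).filter (fun k => P ^ k ∣ g)).card =
      (UniqueFactorizationMonoid.normalizedFactors g).count P := by
  obtain ⟨hgm, hgn⟩ := mem_mon.mp hg
  have hdvd : ∀ k, P ^ k ∣ g ↔ k ≤ (UniqueFactorizationMonoid.normalizedFactors g).count P := by
    intro k
    rw [pow_dvd_iff_le_emultiplicity,
      UniqueFactorizationMonoid.emultiplicity_eq_count_normalizedFactors hPi hgm.ne_zero,
      hP.normalize_eq_self]
    exact Nat.cast_le
  have hle : (UniqueFactorizationMonoid.normalizedFactors g).count P ≤ n := by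
    have h1 := (hdvd _).mpr le_rfl
    have h2 := natDegree_le_of_dvd h1 hgm.ne_zero
    rw [natDegree_pow, hgn] at h2
    exact (Nat.le_mul_of_pos_right _ hPi.natDegree_pos).trans h2
  have : (Icc 1 n).filter (fun k => P ^ k ∣ g) =
      Icc 1 ((UniqueFactorizationMonoid.normalizedFactors g).count P) := by
    ext k
    simp only [mem_filter, Finset.mem_Icc, hdvd]
    omega
  rw [this]; simp

open Classical in
lemma deg_eq_sum {F : Type*} [Field F] [Fintype F] {n : ℕ} {g : F[X]} (hg : g ∈ mon F n) :
    n = ∑ e ∈ Icc 1 n, ∑ P ∈ (mon F e).filter Irreducible,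
      ∑ k ∈ Icc 1 n, if P ^ k ∣ g then e else 0 := by
  obtain ⟨hgm, hgn⟩ := mem_mon.mp hg
  have h1 : ∀ e ∈ Icc 1 n, ∀ P ∈ (mon F e).filter Irreducible,
      (∑ k ∈ Icc 1 n, if P ^ k ∣ g then e else 0) =
      (UniqueFactorizationMonoid.normalizedFactors g).count P * P.natDegree := by
    intro e _ P hP
    obtain ⟨hP1, hP2⟩ := mem_filter.mp hP
    obtain ⟨hP3, hP4⟩ := mem_mon.mp hP1
    rw [← card_pow_dvd hg hP3 hP2, ← Finset.sum_filter, Finset.sum_const, hP4, smul_eq_mul]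
  rw [Finset.sum_congr rfl fun e he => Finset.sum_congr rfl (h1 e he), Finset.sum_sigma']
  have h2 : ((UniqueFactorizationMonoid.normalizedFactors g).map natDegree).sum = n := by
    rw [← hgn]
    have := UniqueFactorizationMonoid.prod_normalizedFactors_eq hgm.ne_zero
    rw [hgm.normalize_eq_self] at this
    conv_rhs => rw [← this]
    rw [natDegree_multiset_prod]
    exact UniqueFactorizationMonoid.zero_notMem_normalizedFactors g
  conv_lhs => rw [← h2]
  rw [Finset.sum_multiset_map_count]
  symm
  have hfac : ∀ P ∈ UniqueFactorizationMonoid.normalizedFactors g,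
      P.Monic ∧ Irreducible P ∧ P ∣ g := by
    intro P hP
    have hi := UniqueFactorizationMonoid.irreducible_of_normalized_factor P hP
    refine ⟨?_, hi, UniqueFactorizationMonoid.dvd_of_mem_normalizedFactors hP⟩
    rw [← UniqueFactorizationMonoid.normalize_normalized_factor P hP]
    exact monic_normalize hi.ne_zero
  refine Finset.sum_bij_ne_zero (fun x _ _ => x.2) ?_ ?_ ?_ ?_
  · rintro ⟨e, P⟩ h hne
    simp only at hne ⊢
    rw [Multiset.mem_toFinset, ← Multiset.count_pos]
    exact Nat.pos_of_ne_zero (left_ne_zero_of_mul hne)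
  · rintro ⟨e, P⟩ h hne ⟨e', P'⟩ h' hne' heq
    simp only at heq
    subst heq
    simp only [Finset.mem_sigma, mem_filter, mem_mon] at h h'
    have : e = e' := by rw [← h.2.1.2, ← h'.2.1.2]
    subst this; rfl
  · intro P hP hne
    rw [Multiset.mem_toFinset] at hP
    obtain ⟨a1, a2, a3⟩ := hfac P hP
    refine ⟨⟨P.natDegree, P⟩, ?_, by simpa using hne, rfl⟩
    simp only [Finset.mem_sigma, mem_filter, mem_mon, Finset.mem_Icc]
    refine ⟨⟨a2.natDegree_pos, ?_⟩, ⟨a1, trivial⟩, a2⟩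
    rw [← hgn]
    exact natDegree_le_of_dvd a3 hgm.ne_zero
  · rintro ⟨e, P⟩ h hne
    simp

open Classical in
/-- logarithmic sums -/
def Slog {F : Type*} [Field F] [Fintype F] (lam : F[X] → ℂ) (j : ℕ) : ℂ :=
  ∑ e ∈ j.divisors, ∑ P ∈ (mon F e).filter Irreducible, (e : ℂ) * lam P ^ (j / e)

open Classical in
lemma sum_multiples {F : Type*} [Field F] [Fintype F] (lam : F[X] → ℂ) (h1 : lam 1 = 1)
    (hmul : ∀ g h : F[X], g.Monic → h.Monic → lam (g * h) = lam g * lam h) (n e k : ℕ)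
    {P : F[X]} (hP : P ∈ mon F e) :
    ∑ g ∈ (mon F n).filter (fun g => P ^ k ∣ g), lam g =
      if e * k ≤ n then lam P ^ k * ∑ h ∈ mon F (n - e * k), lam h else 0 := by
  obtain ⟨hPm, hPd⟩ := mem_mon.mp hP
  have hpow : lam (P ^ k) = lam P ^ k := by
    induction k with
    | zero => simp [h1]
    | succ k ih => rw [pow_succ, hmul _ _ (hPm.pow k) hPm, ih, pow_succ]
  have hdeg : (P ^ k).natDegree = e * k := by rw [natDegree_pow, hPd, mul_comm]
  split_ifs with hle
  · rw [Finset.mul_sum]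
    symm
    refine Finset.sum_bij (fun h _ => P ^ k * h) ?_ ?_ ?_ ?_
    · intro h hh
      obtain ⟨hm, hd⟩ := mem_mon.mp hh
      rw [mem_filter, mem_mon]
      refine ⟨⟨(hPm.pow k).mul hm, ?_⟩, dvd_mul_right _ _⟩
      rw [(hPm.pow k).natDegree_mul hm, hdeg, hd]; omega
    · intro a _ b _ hab
      exact mul_left_cancel₀ (hPm.pow k).ne_zero hab
    · intro g hg
      obtain ⟨hg1, h, rfl⟩ := mem_filter.mp hg
      obtain ⟨hm, hd⟩ := mem_mon.mp hg1
      have hm' : h.Monic := (hPm.pow k).of_mul_monic_left hm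
      refine ⟨h, ?_, rfl⟩
      rw [mem_mon]
      refine ⟨hm', ?_⟩
      rw [(hPm.pow k).natDegree_mul hm', hdeg] at hd
      omega
    · intro h hh
      rw [hmul _ _ (hPm.pow k) (mem_mon.mp hh).1, hpow]
  · rw [Finset.filter_false_of_mem, Finset.sum_empty]
    intro g hg hdvd
    obtain ⟨hm, hd⟩ := mem_mon.mp hg
    have := natDegree_le_of_dvd hdvd hm.ne_zero
    omega

lemma sum_reindex (n : ℕ) (f : ℕ → ℕ → ℂ) :
    ∑ e ∈ Icc 1 n, ∑ k ∈ Icc 1 n, (if e * k ≤ n then f e k else 0) =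
      ∑ j ∈ Icc 1 n, ∑ e ∈ j.divisors, f e (j / e) := by
  rw [Finset.sum_sigma', Finset.sum_sigma']
  refine Finset.sum_bij_ne_zero (fun x _ _ => ⟨x.1 * x.2, x.1⟩) ?_ ?_ ?_ ?_
  · rintro ⟨e, k⟩ h hne
    simp only [Finset.mem_sigma, Finset.mem_Icc, Nat.mem_divisors] at h ⊢
    have : e * k ≤ n := by
      by_contra hcon
      simp [hcon] at hne
    have : 0 < e * k := Nat.mul_pos h.1.1 h.2.1
    exact ⟨⟨by omega, by omega⟩, dvd_mul_right _ _, by omega⟩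
  · rintro ⟨e, k⟩ h hne ⟨e', k'⟩ h' hne' heq
    simp only [Sigma.mk.injEq, heq_eq_eq] at heq
    obtain ⟨h3, rfl⟩ := heq
    simp only [Finset.mem_sigma, Finset.mem_Icc] at h
    have := Nat.eq_of_mul_eq_mul_left h.1.1 h3
    subst this; rfl
  · rintro ⟨j, e⟩ h hne
    simp only [Finset.mem_sigma, Finset.mem_Icc, Nat.mem_divisors] at h
    obtain ⟨⟨hj1, hj2⟩, ⟨k, rfl⟩, hj0⟩ := h
    have he : 0 < e := Nat.pos_of_ne_zero (left_ne_zero_of_mul hj0)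
    have hk : 0 < k := Nat.pos_of_ne_zero (right_ne_zero_of_mul hj0)
    have hen : e ≤ e * k := Nat.le_mul_of_pos_right _ hk
    have hkn : k ≤ e * k := Nat.le_mul_of_pos_left _ he
    refine ⟨⟨e, k⟩, ?_, ?_, rfl⟩
    · simp only [Finset.mem_sigma, Finset.mem_Icc]
      omega
    · simp only [if_pos hj2]
      simpa only [Nat.mul_div_cancel_left _ he] using hne
  · rintro ⟨e, k⟩ h hne
    simp only [Finset.mem_sigma, Finset.mem_Icc] at h
    have : e * k ≤ n := by
      by_contra hcon
      simp [hcon] at hne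
    simp only [if_pos this, Nat.mul_div_cancel_left _ h.1.1]

lemma newton {F : Type*} [Field F] [Fintype F] (lam : F[X] → ℂ) (h1 : lam 1 = 1)
    (hmul : ∀ g h : F[X], g.Monic → h.Monic → lam (g * h) = lam g * lam h) (n : ℕ) :
    (n : ℂ) * ∑ g ∈ mon F n, lam g =
      ∑ j ∈ Icc 1 n, Slog lam j * ∑ g ∈ mon F (n - j), lam g := by
  classical
  calc (n : ℂ) * ∑ g ∈ mon F n, lam g
      = ∑ g ∈ mon F n, ∑ e ∈ Icc 1 n, ∑ P ∈ (mon F e).filter Irreducible,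
          ∑ k ∈ Icc 1 n, if P ^ k ∣ g then (e : ℂ) * lam g else 0 := by
        rw [Finset.mul_sum]
        refine Finset.sum_congr rfl fun g hg => ?_
        conv_lhs => rw [deg_eq_sum hg]
        push_cast
        simp only [Finset.sum_mul, ite_mul, zero_mul]
    _ = ∑ e ∈ Icc 1 n, ∑ P ∈ (mon F e).filter Irreducible, ∑ k ∈ Icc 1 n,
          ∑ g ∈ mon F n, if P ^ k ∣ g then (e : ℂ) * lam g else 0 := by
        rw [Finset.sum_comm]
        refine Finset.sum_congr rfl fun e _ => ?_
        rw [Finset.sum_comm]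
        refine Finset.sum_congr rfl fun P _ => ?_
        rw [Finset.sum_comm]
    _ = ∑ e ∈ Icc 1 n, ∑ k ∈ Icc 1 n, ∑ P ∈ (mon F e).filter Irreducible,
          if e * k ≤ n then (e : ℂ) * lam P ^ k * ∑ h ∈ mon F (n - e * k), lam h else 0 := by
        refine Finset.sum_congr rfl fun e _ => ?_
        rw [Finset.sum_comm]
        refine Finset.sum_congr rfl fun k _ => Finset.sum_congr rfl fun P hP => ?_
        rw [← Finset.sum_filter, ← Finset.mul_sum,
          sum_multiples lam h1 hmul n e k (mem_filter.mp hP).1]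
        split_ifs
        · ring
        · simp
    _ = ∑ j ∈ Icc 1 n, Slog lam j * ∑ g ∈ mon F (n - j), lam g := by
        have h := sum_reindex n (fun e k => ∑ P ∈ (mon F e).filter Irreducible,
          (e : ℂ) * lam P ^ k * ∑ h ∈ mon F (n - e * k), lam h)
        have h' : ∀ e k, (∑ P ∈ (mon F e).filter Irreducible,
            if e * k ≤ n then (e : ℂ) * lam P ^ k * ∑ h ∈ mon F (n - e * k), lam h else 0) =
            if e * k ≤ n then ∑ P ∈ (mon F e).filter Irreducible,
              (e : ℂ) * lam P ^ k * ∑ h ∈ mon F (n - e * k), lam h else 0 := by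
          intro e k
          split_ifs <;> simp
        simp only [h']
        rw [h]
        refine Finset.sum_congr rfl fun j _ => ?_
        rw [Slog, Finset.sum_mul]
        refine Finset.sum_congr rfl fun e he => ?_
        rw [Finset.sum_mul, Nat.mul_div_cancel' (Nat.dvd_of_mem_divisors he)]

end LfunSection


noncomputable section LfunSection2

open Polynomial

open IntermediateField in
lemma adjoin_inv_eq {F K : Type*} [Field F] [Field K] [Algebra F K] (x : K) :
    F⟮x⁻¹⟯ = F⟮x⟯ := by
  apply le_antisymm
  · rw [adjoin_simple_le_iff]
    exact inv_mem (mem_adjoin_simple_self F x)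
  · rw [adjoin_simple_le_iff]
    have := inv_mem (mem_adjoin_simple_self F x⁻¹)
    rwa [inv_inv] at this

lemma natDegree_minpoly_inv {F K : Type*} [Field F] [Field K] [Algebra F K]
    [FiniteDimensional F K] (x : K) :
    (minpoly F x⁻¹).natDegree = (minpoly F x).natDegree := by
  rw [← IntermediateField.adjoin.finrank (Algebra.IsIntegral.isIntegral x),
    ← IntermediateField.adjoin.finrank (Algebra.IsIntegral.isIntegral x⁻¹), adjoin_inv_eq]

lemma reverse_minpoly {F K : Type*} [Field F] [Field K] [Algebra F K]
    [FiniteDimensional F K] (x : K) (hx : x ≠ 0) :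
    (minpoly F x).reverse = C ((minpoly F x).coeff 0) * minpoly F x⁻¹ := by
  have hIntegral : ∀ y : K, IsIntegral F y := Algebra.IsIntegral.isIntegral
  have h0 := minpoly.coeff_zero_ne_zero (hIntegral x) hx
  have htr : (minpoly F x).natTrailingDegree = 0 :=
    natTrailingDegree_eq_zero.mpr (Or.inr h0)
  have hroot : aeval x⁻¹ (minpoly F x).reverse = 0 := by
    let := invertibleOfNonzero hx
    have := (eval₂_reverse_eq_zero_iff (algebraMap F K) x (minpoly F x)).mpr
      (minpoly.aeval F x)
    rwa [invOf_eq_inv] at this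
  have hdvd := minpoly.dvd F x⁻¹ hroot
  have h := eq_leadingCoeff_mul_of_monic_of_dvd_of_natDegree_le (minpoly.monic (hIntegral x⁻¹)) hdvd
    (by rw [natDegree_minpoly_inv]; exact reverse_natDegree_le _)
  rw [h, reverse_leadingCoeff, trailingCoeff, htr]

lemma nextCoeff_minpoly_inv {F K : Type*} [Field F] [Field K] [Algebra F K]
    [FiniteDimensional F K] (x : K) (hx : x ≠ 0) :
    (minpoly F x⁻¹).nextCoeff = (minpoly F x).coeff 1 / (minpoly F x).coeff 0 := by
  have h := reverse_minpoly (F := F) x⁻¹ (inv_ne_zero hx)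
  rw [inv_inv] at h
  have h0 := minpoly.coeff_zero_ne_zero (A := F) (Algebra.IsIntegral.isIntegral x) hx
  have e1 := congrArg (fun p => coeff p 1) h
  have e0 := congrArg (fun p => coeff p 0) h
  simp only [coeff_one_reverse, coeff_C_mul, coeff_zero_reverse] at e1 e0
  rw [minpoly.monic (Algebra.IsIntegral.isIntegral x⁻¹)] at e0
  rw [e1, eq_div_iff h0]
  linear_combination -(minpoly F x).coeff 1 * e0

/-- the multiplicative function -/
def klam {F : Type*} [Field F] (ψ : AddChar F ℂ) (a b : F) (g : F[X]) : ℂ :=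
  open Classical in
  if g.coeff 0 = 0 then 0 else ψ (-(a * g.nextCoeff) - b * (g.coeff 1 / g.coeff 0))

lemma klam_one {F : Type*} [Field F] (ψ : AddChar F ℂ) (a b : F) : klam ψ a b 1 = 1 := by
  have : (1 : F[X]).nextCoeff = 0 := by rw [← map_one (f := C), nextCoeff_C_eq_zero]
  simp [klam, this, coeff_one]

lemma klam_mul {F : Type*} [Field F] (ψ : AddChar F ℂ) (a b : F) (g h : F[X]) (hg : g.Monic)
    (hh : h.Monic) : klam ψ a b (g * h) = klam ψ a b g * klam ψ a b h := by
  by_cases h1 : g.coeff 0 = 0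
  · simp [klam, mul_coeff_zero, h1]
  by_cases h2 : h.coeff 0 = 0
  · simp [klam, mul_coeff_zero, h2]
  simp only [klam, mul_coeff_zero, h1, h2, mul_eq_zero, or_self, if_false]
  rw [← AddChar.map_add_eq_mul, hg.nextCoeff_mul hh, mul_coeff_one]
  congr 1
  field_simp
  ring

/-- trace sums -/
lemma klam_minpoly {F K : Type*} [Field F] [Field K] [Algebra F K]
    [FiniteDimensional F K] (ψ : AddChar F ℂ) (a b : F) (x : K) (hx : x ≠ 0) :
    klam ψ a b (minpoly F x) ^ (Module.finrank F K / (minpoly F x).natDegree) =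
      ψ (Algebra.trace F K (algebraMap F K a * x + algebraMap F K b * x⁻¹)) := by
  have hIntegral : ∀ y : K, IsIntegral F y := Algebra.IsIntegral.isIntegral
  have h0 := minpoly.coeff_zero_ne_zero (hIntegral x) hx
  have hfr : ∀ y : K, Module.finrank (IntermediateField.adjoin F {y}) K =
      Module.finrank F K / (minpoly F y).natDegree := by
    intro y
    have h1 := Module.finrank_mul_finrank F (IntermediateField.adjoin F {y}) K
    rw [IntermediateField.adjoin.finrank (hIntegral y)] at h1
    rw [← h1, Nat.mul_div_cancel_left _ (minpoly.natDegree_pos (hIntegral y))]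
  have htr : Algebra.trace F K (algebraMap F K a * x + algebraMap F K b * x⁻¹) =
      a * Algebra.trace F K x + b * Algebra.trace F K x⁻¹ := by
    rw [← Algebra.smul_def, ← Algebra.smul_def, map_add, map_smul, map_smul, smul_eq_mul,
      smul_eq_mul]
  rw [htr, trace_eq_finrank_mul_minpoly_nextCoeff,
    trace_eq_finrank_mul_minpoly_nextCoeff, hfr, hfr, natDegree_minpoly_inv,
    nextCoeff_minpoly_inv x hx, klam, if_neg h0, ← AddChar.map_nsmul_eq_pow]
  congr 1
  simp only [nsmul_eq_mul]
  ring

open Classical in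
lemma card_minpoly_eq {F K : Type*} [Field F] [Fintype F] [Field K] [Fintype K] [Algebra F K]
    (P : F[X]) (hP : P.Monic) (hPi : Irreducible P) (hd : P.natDegree ∣ Module.finrank F K) :
    (univ.filter (fun x : K => minpoly F x = P)).card = P.natDegree := by
  have hsplit : (P.map (algebraMap F K)).Splits := by
    have h1 := hPi.natDegree_dvd_iff_dvd_X_pow_card_pow_sub_X.mp hd
    rw [← Module.natCard_eq_pow_finrank, Nat.card_eq_fintype_card] at h1
    refine (FiniteField.isSplittingField_sub K F).splits.of_dvd ?_
      (Polynomial.map_dvd _ h1)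
    exact Polynomial.map_ne_zero (FiniteField.X_pow_card_sub_X_ne_zero _ Fintype.one_lt_card)
  rw [← card_rootSet_eq_natDegree (PerfectField.separable_of_irreducible hPi) hsplit,
    ← Set.toFinset_card]
  congr 1
  ext x
  simp only [mem_filter, mem_univ, true_and, Set.mem_toFinset, mem_rootSet]
  constructor
  · rintro rfl
    exact ⟨hP.ne_zero, minpoly.aeval F x⟩
  · rintro ⟨_, h⟩
    exact (minpoly.eq_of_irreducible_of_monic hPi h hP).symm

lemma klam_X {F : Type*} [Field F] (ψ : AddChar F ℂ) (a b : F) : klam ψ a b X = 0 := by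
  simp [klam]

open Classical in
lemma Slog_eq {F K : Type*} [Field F] [Fintype F] [Field K] [Fintype K] [Algebra F K]
    (ψ : AddChar F ℂ) (a b : F) :
    Slog (klam ψ a b) (Module.finrank F K) =
      ∑ x ∈ univ.filter (fun x : K => x ≠ 0),
        ψ (Algebra.trace F K (algebraMap F K a * x + algebraMap F K b * x⁻¹)) := by
  have hIntegral : ∀ y : K, IsIntegral F y := Algebra.IsIntegral.isIntegral
  set n := Module.finrank F K with hn
  have hnpos : 0 < n := Module.finrank_pos
  have hdeg : ∀ x : K, (minpoly F x).natDegree ∣ n := fun x => minpoly.degree_dvd (hIntegral x)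
  calc Slog (klam ψ a b) n
      = ∑ e ∈ n.divisors, ∑ P ∈ (mon F e).filter Irreducible, ∑ x : K,
          if minpoly F x = P then klam ψ a b P ^ (n / e) else 0 := by
        refine Finset.sum_congr rfl fun e he => Finset.sum_congr rfl fun P hP => ?_
        obtain ⟨hP1, hP2⟩ := mem_filter.mp hP
        obtain ⟨hP3, hP4⟩ := mem_mon.mp hP1
        rw [← Finset.sum_filter, Finset.sum_const, card_minpoly_eq P hP3 hP2, hP4, nsmul_eq_mul]
        rw [hP4]
        exact Nat.dvd_of_mem_divisors he
    _ = ∑ x : K, ∑ e ∈ n.divisors, ∑ P ∈ (mon F e).filter Irreducible,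
          if minpoly F x = P then klam ψ a b P ^ (n / e) else 0 := by
        rw [Finset.sum_comm]
        refine Finset.sum_congr rfl fun e he => ?_
        rw [Finset.sum_comm]
    _ = ∑ x : K, klam ψ a b (minpoly F x) ^ (n / (minpoly F x).natDegree) := by
        refine Finset.sum_congr rfl fun x _ => ?_
        rw [Finset.sum_eq_single (minpoly F x).natDegree]
        · rw [Finset.sum_ite_eq, if_pos]
          rw [mem_filter, mem_mon]
          exact ⟨⟨minpoly.monic (hIntegral x), rfl⟩, minpoly.irreducible (hIntegral x)⟩
        · intro e _ hne
          rw [Finset.sum_ite_eq, if_neg]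
          rw [mem_filter, mem_mon]
          exact fun h => hne h.1.2.symm
        · intro h
          exact absurd (Nat.mem_divisors.mpr ⟨hdeg x, hnpos.ne'⟩) h
    _ = _ := by
        rw [Finset.sum_filter]
        refine Finset.sum_congr rfl fun x _ => ?_
        by_cases hx : x = 0
        · subst hx
          rw [if_neg (by simp), minpoly.zero, klam_X, zero_pow]
          rw [natDegree_X, Nat.div_one]
          exact hnpos.ne'
        · rw [if_pos hx, ← klam_minpoly ψ a b x hx]

end LfunSection2


noncomputable section LfunSection3

open Polynomial

lemma klam_monOf {F : Type*} [Field F] (ψ : AddChar F ℂ) (a b : F) (m : ℕ)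
    (c : Fin (m + 2) → F) : klam ψ a b (monOf (m + 2) c) =
      open Classical in if c 0 = 0 then 0 else
        ψ (-(a * c (Fin.last (m + 1))) - b * (c 1 / c 0)) := by
  obtain ⟨h1, h2⟩ := monOf_monic (m + 2) c
  have e0 : (monOf (m + 2) c).coeff 0 = c 0 := monOf_coeff (m + 2) c 0
  have e1 : (monOf (m + 2) c).coeff 1 = c 1 := monOf_coeff (m + 2) c 1
  have e2 : (monOf (m + 2) c).nextCoeff = c (Fin.last (m + 1)) := by
    rw [nextCoeff_of_natDegree_pos (by omega), h2]
    exact monOf_coeff (m + 2) c (Fin.last (m + 1))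
  rw [klam, e0, e1, e2]

lemma A_zero {F : Type*} [Field F] [Fintype F] (ψ : AddChar F ℂ) (a b : F) :
    ∑ g ∈ mon F 0, klam ψ a b g = 1 := by
  have : monOf 0 = fun _ : Fin 0 → F => 1 := by ext; simp [monOf]
  rw [mon, Finset.sum_map]
  simp [this, klam_one]

lemma A_two {F : Type*} [Field F] [Fintype F] (ψ : AddChar F ℂ) (hψ : ψ ≠ 1) (a b : F)
    (ha : a ≠ 0) (hb : b ≠ 0) :
    ∑ g ∈ mon F 2, klam ψ a b g = Fintype.card F := by
  classical
  have hprim := AddChar.IsPrimitive.of_ne_one hψ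
  rw [mon, Finset.sum_map]
  simp only [Function.Embedding.coeFn_mk]
  have : ∀ c : Fin 2 → F, klam ψ a b (monOf 2 c) = (fun p : F × F => if p.1 = 0 then 0 else
        ψ (p.2 * (-a - b / p.1))) (finTwoArrowEquiv F c) := by
    intro c
    rw [klam_monOf ψ a b 0 c]
    simp only [finTwoArrowEquiv_apply]
    congr 2
    simp
    ring
  rw [Finset.sum_congr rfl fun c _ => this c, Equiv.sum_comp (finTwoArrowEquiv F) (fun p : F × F => if p.1 = 0 then 0 else
        ψ (p.2 * (-a - b / p.1))),
    Fintype.sum_prod_type]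
  rw [Finset.sum_eq_single (-b / a)]
  · have h0 : -b / a ≠ 0 := div_ne_zero (neg_ne_zero.mpr hb) ha
    have : -a - b / (-b / a) = 0 := by field_simp; ring
    simp only [if_neg h0, this]
    simp
  · intro x _ hx
    by_cases h : x = 0
    · simp [h]
    · simp only [if_neg h]
      rw [AddChar.sum_mulShift _ hprim, if_neg]
      · simp
      · intro h2
        apply hx
        field_simp at h2 ⊢
        linear_combination -h2
  · simp

lemma A_ge {F : Type*} [Field F] [Fintype F] (ψ : AddChar F ℂ) (hψ : ψ ≠ 1) (a b : F)
    (ha : a ≠ 0) (m : ℕ) :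
    ∑ g ∈ mon F (m + 3), klam ψ a b g = 0 := by
  classical
  obtain ⟨e, he⟩ := AddChar.ne_one_iff.mp hψ
  rw [mon, Finset.sum_map]
  simp only [Function.Embedding.coeFn_mk]
  set S := ∑ c : Fin (m + 3) → F, klam ψ a b (monOf (m + 3) c) with hS
  have h1 : S = ψ e * S := by
    conv_lhs => rw [hS, ← Equiv.sum_comp (Equiv.addRight
      (Pi.single (Fin.last (m + 2)) (-e / a) : Fin (m + 3) → F))]
    rw [hS, Finset.mul_sum]
    refine Finset.sum_congr rfl fun c _ => ?_
    rw [klam_monOf ψ a b (m + 1) c, klam_monOf ψ a b (m + 1)]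
    have n0 : (0 : Fin (m + 3)) ≠ Fin.last (m + 2) := by
      intro h; have := congrArg Fin.val h; simp at this
    have n1 : (1 : Fin (m + 3)) ≠ Fin.last (m + 2) := by
      intro h; have := congrArg Fin.val h; simp at this
    simp only [Equiv.coe_addRight, Pi.add_apply, Pi.single_eq_of_ne n0, Pi.single_eq_of_ne n1,
      Pi.single_eq_same, add_zero]
    split_ifs
    · simp
    · rw [← AddChar.map_add_eq_mul]
      congr 1
      field_simp
      ring
  have h2 : (ψ e - 1) * S = 0 := by linear_combination -h1
  exact (mul_eq_zero.mp h2).resolve_left (sub_ne_zero.mpr he)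

lemma Slog_rec {F : Type*} [Field F] [Fintype F] (ψ : AddChar F ℂ) (hψ : ψ ≠ 1) (a b : F)
    (ha : a ≠ 0) (hb : b ≠ 0) :
    Slog (klam ψ a b) 2 = 2 * Fintype.card F - Slog (klam ψ a b) 1 ^ 2 ∧
    ∀ n, Slog (klam ψ a b) (n + 3) = - Slog (klam ψ a b) 1 * Slog (klam ψ a b) (n + 2)
      - Fintype.card F * Slog (klam ψ a b) (n + 1) := by
  have hN := newton (klam ψ a b) (klam_one ψ a b) (klam_mul ψ a b)
  have hA1 : ∑ g ∈ mon F 1, klam ψ a b g = Slog (klam ψ a b) 1 := by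
    have := hN 1
    simpa [A_zero] using this
  constructor
  · have := hN 2
    rw [A_two ψ hψ a b ha hb, Finset.sum_Icc_succ_top (by norm_num)] at this
    simp [A_zero, hA1] at this
    linear_combination -this
  · intro n
    have := hN (n + 3)
    rw [A_ge ψ hψ a b ha n, Finset.sum_Icc_succ_top (by omega),
      Finset.sum_Icc_succ_top (by omega), Finset.sum_Icc_succ_top (by omega),
      Finset.sum_eq_zero] at this
    · have e1 : n + 3 - (n + 1) = 2 := by omega
      have e2 : n + 3 - (n + 2) = 1 := by omega
      have e3 : n + 3 - (n + 3) = 0 := by omega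
      rw [show n + 2 + 1 = n + 3 from rfl, show n + 1 + 1 = n + 2 from rfl, e1, e2, e3, A_zero,
        hA1, A_two ψ hψ a b ha hb] at this
      linear_combination -this
    · intro j hj
      obtain ⟨j1, j2⟩ := Finset.mem_Icc.mp hj
      obtain ⟨r, hr⟩ : ∃ r, n + 3 - j = r + 3 := ⟨n - j, by omega⟩
      rw [hr, A_ge ψ hψ a b ha, mul_zero]

end LfunSection3


noncomputable section WeilSection

lemma Slog_even_bound {F : Type*} [Field F] [Fintype F] (q : ℕ) (hq : Fintype.card F = q)
    (hq3 : 3 ≤ q) (ψ : AddChar F ℂ) (hψ : ψ ≠ 1) (a b : F) (ha : a ≠ 0) (m : ℕ) (hm : 1 ≤ m) :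
    ‖Slog (klam ψ a b) (2 * m)‖ ≤ 4 * q * (q : ℝ) ^ m := by
  classical
  obtain ⟨p, hp⟩ := CharP.exists F
  have hpp : Fact (Nat.Prime p) := ⟨CharP.char_is_prime F p⟩
  have hne : NeZero (2 * m) := ⟨by omega⟩
  let K := FiniteField.Extension F p (2 * m)
  have hfin : Module.finrank F K = 2 * m := FiniteField.finrank_extension F p (2 * m)
  let fK : Fintype K := Fintype.ofFinite K
  have hcard : Fintype.card K = q ^ (2 * m) := by
    rw [Module.card_eq_pow_finrank (K := F), hq, hfin]
  have hst := stepanov (F := F) (K := K) q m hq hq3 hm hfin a b ha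
  set B : ℕ := q ^ (2 * m - 1) + 3 * q ^ m with hB
  set N : F → ℕ := fun c => (univ.filter (fun x : K => x ≠ 0 ∧
    Algebra.trace F K (algebraMap F K a * x + algebraMap F K b * x⁻¹) = c)).card with hN
  have hS : Slog (klam ψ a b) (2 * m) = ∑ c : F, (N c : ℂ) * ψ c := by
    rw [← hfin, Slog_eq (K := K), ← Finset.sum_fiberwise (univ.filter (fun x : K => x ≠ 0))
      (fun x => Algebra.trace F K (algebraMap F K a * x + algebraMap F K b * x⁻¹))]
    refine Finset.sum_congr rfl fun c _ => ?_
    rw [Finset.sum_congr rfl (g := fun _ => ψ c), Finset.sum_const, nsmul_eq_mul, hN,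
      Finset.filter_filter]
    intro x hx
    rw [(mem_filter.mp hx).2]
  have hsumN : ∑ c : F, N c = q ^ (2 * m) - 1 := by
    have h1 := Finset.card_eq_sum_card_fiberwise (s := univ.filter (fun x : K => x ≠ 0))
      (f := fun x => Algebra.trace F K (algebraMap F K a * x + algebraMap F K b * x⁻¹))
      (t := univ) (fun _ _ => by simp)
    rw [Finset.filter_ne', Finset.card_erase_of_mem (mem_univ _), Finset.card_univ, hcard] at h1
    rw [h1]
    refine Finset.sum_congr rfl fun c _ => ?_
    rw [hN, ← Finset.filter_ne', Finset.filter_filter]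
  have hψ0 : ∑ c : F, ψ c = 0 := AddChar.sum_eq_zero_of_ne_one hψ
  have hS2 : Slog (klam ψ a b) (2 * m) = - ∑ c : F, (((B : ℝ) - N c : ℝ) : ℂ) * ψ c := by
    rw [hS]
    simp only [Complex.ofReal_sub, Complex.ofReal_natCast, sub_mul, Finset.sum_sub_distrib,
      ← Finset.mul_sum, hψ0]
    ring
  have hq1 : 1 ≤ q ^ (2 * m) := Nat.one_le_pow _ _ (by omega)
  have hsumR : ∑ c : F, ((N c : ℕ) : ℝ) = (q : ℝ) ^ (2 * m) - 1 := by
    rw [← Nat.cast_sum, hsumN, Nat.cast_sub hq1]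
    push_cast
    ring
  rw [hS2, norm_neg]
  calc ‖∑ c : F, (((B : ℝ) - N c : ℝ) : ℂ) * ψ c‖
      ≤ ∑ c : F, ((B : ℝ) - N c) := by
        refine (norm_sum_le _ _).trans (Finset.sum_le_sum fun c _ => ?_)
        rw [norm_mul, AddChar.norm_apply, mul_one, Complex.norm_real, Real.norm_of_nonneg]
        rw [sub_nonneg]
        exact_mod_cast hst c
    _ = 3 * q * (q : ℝ) ^ m + 1 := by
        rw [Finset.sum_sub_distrib, hsumR, Finset.sum_const, Finset.card_univ, hq, nsmul_eq_mul,
          hB]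
        push_cast
        have : (q : ℝ) ^ (2 * m) = q * (q : ℝ) ^ (2 * m - 1) := by
          rw [← pow_succ']
          congr 1
          omega
        rw [this]
        ring
    _ ≤ 4 * q * (q : ℝ) ^ m := by
        have h1 : (1 : ℝ) ≤ q := by exact_mod_cast (by omega : 1 ≤ q)
        have h2 : (1 : ℝ) ≤ (q : ℝ) ^ m := one_le_pow₀ h1
        nlinarith

/-- Kloosterman sum -/
def Kl {F : Type*} [Field F] [Fintype F] (ψ : AddChar F ℂ) (a b : F) : ℂ :=
  open Classical in ∑ x ∈ univ.filter (fun x : F => x ≠ 0), ψ (a * x + b * x⁻¹)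

lemma Slog_one_eq {F : Type*} [Field F] [Fintype F] (ψ : AddChar F ℂ) (a b : F) :
    Slog (klam ψ a b) 1 = Kl ψ a b := by
  have := Slog_eq (F := F) (K := F) ψ a b
  rw [Module.finrank_self] at this
  rw [this, Kl]
  refine Finset.sum_congr rfl fun x _ => ?_
  simp [Algebra.trace_self]

lemma Kl_conj {F : Type*} [Field F] [Fintype F] (ψ : AddChar F ℂ) (a b : F) :
    (starRingEnd ℂ) (Kl ψ a b) = Kl ψ a b := by
  classical
  rw [Kl, map_sum]
  refine Finset.sum_nbij' (fun x => -x) (fun x => -x) ?_ ?_ ?_ ?_ ?_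
  · intro x hx; simpa using hx
  · intro x hx; simpa using hx
  · intro x _; simp
  · intro x _; simp
  · intro x _
    rw [← AddChar.map_neg_eq_conj]
    congr 1
    rw [inv_neg]
    ring

theorem weil_kloosterman {F : Type*} [Field F] [Fintype F] (q : ℕ) (hq : Fintype.card F = q)
    (hq3 : 3 ≤ q) (ψ : AddChar F ℂ) (hψ : ψ ≠ 1) (a b : F) (ha : a ≠ 0) (hb : b ≠ 0) :
    ‖Kl ψ a b‖ ≤ 2 * Real.sqrt q := by
  obtain ⟨κ, hκ⟩ := Complex.conj_eq_iff_real.mp (Kl_conj ψ a b)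
  rw [hκ, Complex.norm_real, Real.norm_eq_abs]
  have hq0 : (0 : ℝ) < q := by exact_mod_cast (by omega : 0 < q)
  by_contra! hcon
  have hsq : 4 * (q : ℝ) < κ ^ 2 := by
    have h1 : (2 * Real.sqrt q) ^ 2 < |κ| ^ 2 := by
      gcongr
    rw [sq_abs, mul_pow, Real.sq_sqrt hq0.le] at h1
    linarith
  set D := Real.sqrt (κ ^ 2 - 4 * q) with hD
  have hD2 : D ^ 2 = κ ^ 2 - 4 * q := Real.sq_sqrt (by linarith)
  have hDpos : 0 < D := Real.sqrt_pos.mpr (by linarith)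
  set α := (-κ + D) / 2 with hα
  set β := (-κ - D) / 2 with hβ
  have hsum : α + β = -κ := by rw [hα, hβ]; ring
  have hprod : α * β = q := by rw [hα, hβ]; linear_combination -hD2 / 4
  have hne : α ^ 2 ≠ β ^ 2 := by
    intro h
    have h1 : κ * D = 0 := by rw [hα, hβ] at h; linear_combination -h
    rcases mul_eq_zero.mp h1 with h2 | h2
    · rw [h2] at hsq; nlinarith
    · exact hDpos.ne' h2
  obtain ⟨r2, rn⟩ := Slog_rec ψ hψ a b ha hb
  rw [Slog_one_eq, hκ, hq] at r2 rn
  have hS : ∀ n : ℕ, Slog (klam ψ a b) (n + 1) = ((-(α ^ (n + 1) + β ^ (n + 1)) : ℝ) : ℂ) ∧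
      Slog (klam ψ a b) (n + 2) = ((-(α ^ (n + 2) + β ^ (n + 2)) : ℝ) : ℂ) := by
    intro n
    induction n with
    | zero =>
      constructor
      · rw [zero_add, Slog_one_eq, hκ]
        congr 1
        linear_combination -hsum
      · rw [zero_add, r2]
        have : 2 * (q : ℝ) - κ ^ 2 = -(α ^ 2 + β ^ 2) := by
          linear_combination (α + β - κ) * hsum - 2 * hprod
        rw [← this]
        push_cast
        ring
    | succ n ih =>
      refine ⟨ih.2, ?_⟩
      have e : n + 1 + 2 = n + 3 := by ring
      rw [e, rn, ih.1, ih.2]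
      have : -κ * (-(α ^ (n + 2) + β ^ (n + 2))) - q * (-(α ^ (n + 1) + β ^ (n + 1))) =
          -(α ^ (n + 3) + β ^ (n + 3)) := by
        rw [← hsum, ← hprod]
        ring
      rw [← this]
      push_cast
      ring
  have hbd : ∀ m : ℕ, 1 ≤ m → (α ^ 2) ^ m + (β ^ 2) ^ m ≤ 4 * q * (q : ℝ) ^ m := by
    intro m hm
    have h1 := Slog_even_bound q hq hq3 ψ hψ a b ha m hm
    obtain ⟨r, hr⟩ : ∃ r, 2 * m = r + 1 := ⟨2 * m - 1, by omega⟩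
    rw [hr, (hS r).1, ← hr, Complex.norm_real, Real.norm_eq_abs, abs_neg, pow_mul, pow_mul] at h1
    exact (le_abs_self _).trans h1
  obtain ⟨γ, hγ, hγb⟩ : ∃ γ : ℝ, q < γ ∧ ∀ m : ℕ, 1 ≤ m → γ ^ m ≤ 4 * q * (q : ℝ) ^ m := by
    have hp2 : α ^ 2 * β ^ 2 = q ^ 2 := by rw [← mul_pow, hprod]
    have ha2 := sq_nonneg α
    have hb2 := sq_nonneg β
    rcases lt_or_gt_of_ne hne with h | h
    · refine ⟨β ^ 2, ?_, fun m hm => ?_⟩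
      · by_contra! h3; nlinarith
      · have := hbd m hm; have := pow_nonneg ha2 m; linarith
    · refine ⟨α ^ 2, ?_, fun m hm => ?_⟩
      · by_contra! h3; nlinarith
      · have := hbd m hm; have := pow_nonneg hb2 m; linarith
  have h1 : 1 < γ / q := (one_lt_div hq0).mpr hγ
  obtain ⟨n, hn⟩ := pow_unbounded_of_one_lt (4 * (q : ℝ)) h1
  have hn2 : 4 * (q : ℝ) < (γ / q) ^ (n + 1) :=
    hn.trans (pow_lt_pow_right₀ h1 (Nat.lt_succ_self n))
  rw [div_pow, lt_div_iff₀ (by positivity)] at hn2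
  exact absurd (hγb (n + 1) (by omega)) (not_le.mpr hn2)

end WeilSection


noncomputable section SalieSection

lemma two_ne {F : Type*} [Field F] (h2 : ringChar F ≠ 2) : (2 : F) ≠ 0 :=
  Ring.two_ne_zero h2

variable {F : Type*} [Field F] [Fintype F]

/-- quadratic character with values in ℂ -/
def eta (s : F) : ℂ := open Classical in ((quadraticChar F s : ℤ) : ℂ)

lemma eta_mul (s t : F) : eta (s * t) = eta s * eta t := by
  rw [eta, eta, eta, map_mul, Int.cast_mul]

lemma eta_zero : eta (0 : F) = 0 := by simp [eta]

lemma eta_sq (s : F) (hs : s ≠ 0) : eta s ^ 2 = 1 := by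
  classical
  have h := quadraticChar_sq_one (F := F) hs
  rw [eta]
  exact_mod_cast h

lemma eta_norm (s : F) (hs : s ≠ 0) : ‖eta s‖ = 1 := by
  have h := congrArg norm (eta_sq s hs)
  rw [norm_pow, norm_one] at h
  exact (pow_eq_one_iff_of_nonneg (norm_nonneg _) two_ne_zero).mp h

lemma sum_char_mul (ψ : AddChar F ℂ) (hψ : ψ ≠ 1) (c : F) (hc : c ≠ 0) :
    ∑ y : F, ψ (c * y) = 0 := by
  rw [← AddChar.sum_eq_zero_of_ne_one hψ]
  exact Fintype.sum_equiv (Equiv.mulLeft₀ c hc) _ ψ (fun _ => rfl)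

/-- quadratic Gauss sum -/
def gs (ψ : AddChar F ℂ) : ℂ := ∑ z : F, ψ (z ^ 2)

lemma card_sqrts_eta (h2 : ringChar F ≠ 2) (y : F) :
    (open Classical in ((univ.filter (fun z : F => z ^ 2 = y)).card : ℂ)) = 1 + eta y := by
  classical
  have h := quadraticChar_card_sqrts h2 y
  have h3 : {x : F | x ^ 2 = y}.toFinset = univ.filter (fun z : F => z ^ 2 = y) := by
    ext; simp
  rw [h3] at h
  rw [eta, add_comm]
  exact_mod_cast h

lemma sum_sq (h2 : ringChar F ≠ 2) (ψ : AddChar F ℂ) (hψ : ψ ≠ 1) (c : F) (hc : c ≠ 0) :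
    ∑ z : F, ψ (c * z ^ 2) = eta c * gs ψ := by
  classical
  have key : ∀ c : F, c ≠ 0 → ∑ z : F, ψ (c * z ^ 2) = ∑ y : F, eta y * ψ (c * y) := by
    intro c hc
    rw [← Finset.sum_fiberwise univ (fun z : F => z ^ 2)]
    have : ∀ y : F, ∑ z ∈ univ.filter (fun z : F => z ^ 2 = y), ψ (c * z ^ 2) =
        (1 + eta y) * ψ (c * y) := by
      intro y
      rw [← card_sqrts_eta h2, ← nsmul_eq_mul, ← Finset.sum_const]
      exact Finset.sum_congr rfl fun z hz => by rw [(mem_filter.mp hz).2]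
    simp only [this, add_mul, one_mul, Finset.sum_add_distrib]
    rw [sum_char_mul ψ hψ c hc, zero_add]
  have h1 := key 1 one_ne_zero
  simp only [one_mul] at h1
  rw [key c hc, gs, h1, Finset.mul_sum, Fintype.sum_equiv (Equiv.mulLeft₀ c hc) _
    (fun y => eta c * (eta y * ψ y))]
  intro y
  simp only [Equiv.mulLeft₀_apply, eta_mul]
  have := eta_sq c hc
  linear_combination (-(eta y * ψ (c * y))) * this

lemma gs_norm (h2 : ringChar F ≠ 2) (ψ : AddChar F ℂ) (hψ : ψ ≠ 1) :
    ‖gs ψ‖ = Real.sqrt (Fintype.card F) := by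
  classical
  have hprim := AddChar.IsPrimitive.of_ne_one hψ
  have h : gs ψ * (starRingEnd ℂ) (gs ψ) = Fintype.card F := by
    rw [gs, map_sum, Finset.sum_mul_sum, Finset.sum_comm]
    have : ∀ y : F, ∑ x : F, ψ (x ^ 2) * (starRingEnd ℂ) (ψ (y ^ 2)) =
        ∑ h : F, ψ (y * (2 * h)) * ψ (h ^ 2) := by
      intro y
      rw [← Equiv.sum_comp (Equiv.addRight y)]
      refine Finset.sum_congr rfl fun x _ => ?_
      rw [← AddChar.map_neg_eq_conj, ← AddChar.map_add_eq_mul, ← AddChar.map_add_eq_mul]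
      congr 1
      simp only [Equiv.coe_addRight]
      ring
    simp only [this]
    rw [Finset.sum_comm]
    simp only [← Finset.sum_mul]
    rw [Finset.sum_eq_single 0]
    · simp
    · intro x _ hx
      rw [AddChar.sum_mulShift _ hprim, if_neg (mul_ne_zero (two_ne h2) hx)]
      simp
    · simp
  rw [Complex.mul_conj, Complex.normSq_eq_norm_sq] at h
  have h' : ‖gs ψ‖ ^ 2 = (Fintype.card F : ℝ) := by exact_mod_cast h
  rw [← h', Real.sqrt_sq (norm_nonneg _)]

/-- Salie sum -/
def Sal (ψ : AddChar F ℂ) (a b : F) : ℂ :=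
  open Classical in ∑ x ∈ univ.filter (fun x : F => x ≠ 0), eta x * ψ (a * x + b * x⁻¹)

lemma Sal_core (h2 : ringChar F ≠ 2) (ψ : AddChar F ℂ) (hψ : ψ ≠ 1) (a u : F) :
    gs ψ * Sal ψ a (-u ^ 2) =
      (open Classical in Fintype.card F * ∑ z ∈ univ.filter (fun z : F => z ^ 2 = -a),
        ψ (2 * u * z)) - ∑ z : F, ψ (2 * u * z) := by
  classical
  have hprim := AddChar.IsPrimitive.of_ne_one hψ
  have step : ∀ s ∈ univ.filter (fun x : F => x ≠ 0),
      gs ψ * (eta s * ψ (a * s + -u ^ 2 * s⁻¹)) =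
      ∑ z : F, ψ (s * (z ^ 2 + a)) * ψ (2 * u * z) := by
    intro s hs
    have hs0 : s ≠ 0 := (mem_filter.mp hs).2
    rw [← mul_assoc, mul_comm (gs ψ), ← sum_sq h2 ψ hψ s hs0, Finset.sum_mul,
      ← Equiv.sum_comp (Equiv.addRight (u / s))]
    refine Finset.sum_congr rfl fun x _ => ?_
    rw [← AddChar.map_add_eq_mul, ← AddChar.map_add_eq_mul]
    congr 1
    simp only [Equiv.coe_addRight]
    field_simp
    ring
  rw [Sal, Finset.mul_sum, Finset.sum_congr rfl step, Finset.sum_comm]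
  have h3 : ∀ z : F, ∑ s ∈ univ.filter (fun x : F => x ≠ 0), ψ (s * (z ^ 2 + a)) *
      ψ (2 * u * z) = (if z ^ 2 = -a then (Fintype.card F : ℂ) * ψ (2 * u * z) else 0)
        - ψ (2 * u * z) := by
    intro z
    rw [← Finset.sum_mul, Finset.filter_ne', Finset.sum_erase_eq_sub (mem_univ _),
      AddChar.sum_mulShift _ hprim]
    simp only [add_eq_zero_iff_eq_neg]
    split_ifs <;> simp [sub_mul]
  rw [Finset.sum_congr rfl fun z _ => h3 z, Finset.sum_sub_distrib, ← Finset.sum_filter,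
    Finset.mul_sum]

lemma card_sqrt_le (y : F) :
    (open Classical in (univ.filter (fun z : F => z ^ 2 = y)).card) ≤ 2 := by
  classical
  by_cases h : ∃ r : F, r ^ 2 = y
  · obtain ⟨r, rfl⟩ := h
    refine (Finset.card_le_card (t := {r, -r}) ?_).trans Finset.card_le_two
    intro z hz
    have := (mem_filter.mp hz).2
    simpa using sq_eq_sq_iff_eq_or_eq_neg.mp this
  · push Not at h
    rw [Finset.filter_false_of_mem (fun z _ => h z)]
    simp

lemma Sal_bound (h2 : ringChar F ≠ 2) (ψ : AddChar F ℂ) (hψ : ψ ≠ 1) (a b : F) :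
    ‖Sal ψ a b‖ ≤ 2 * Real.sqrt (Fintype.card F) := by
  classical
  have hq0 : (0 : ℝ) < Fintype.card F := by exact_mod_cast Fintype.card_pos
  have hs0 : 0 < Real.sqrt (Fintype.card F) := Real.sqrt_pos.mpr hq0
  have hss : Real.sqrt (Fintype.card F) * Real.sqrt (Fintype.card F) = Fintype.card F :=
    Real.mul_self_sqrt hq0.le
  have fin : ∀ a u : F, ‖gs ψ * Sal ψ a (-u ^ 2)‖ ≤ 2 * Fintype.card F →
      ‖Sal ψ a (-u ^ 2)‖ ≤ 2 * Real.sqrt (Fintype.card F) := by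
    intro a u h
    rw [norm_mul, gs_norm h2 ψ hψ] at h
    have : Real.sqrt (Fintype.card F) * ‖Sal ψ a (-u ^ 2)‖ ≤
      Real.sqrt (Fintype.card F) * (2 * Real.sqrt (Fintype.card F)) := by linarith
    exact le_of_mul_le_mul_left this hs0
  by_cases hb : b = 0
  · have h1 : b = -(0 : F) ^ 2 := by simp [hb]
    rw [h1]
    apply fin
    rw [Sal_core h2 ψ hψ]
    simp only [mul_zero, zero_mul, AddChar.map_zero_eq_one, Finset.sum_const, nsmul_eq_mul,
      mul_one, Finset.card_univ]
    have h3 := card_sqrt_le (-a)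
    generalize (univ.filter (fun z : F => z ^ 2 = -a)).card = n at h3
    have : (Fintype.card F : ℂ) * n - Fintype.card F =
      ((Fintype.card F * ((n : ℝ) - 1) : ℝ) : ℂ) := by push_cast; ring
    rw [this, Complex.norm_real, Real.norm_eq_abs, abs_mul, abs_of_pos hq0, mul_comm]
    gcongr
    rw [abs_le]
    have : (n : ℝ) ≤ 2 := by exact_mod_cast h3
    have : (0 : ℝ) ≤ n := by positivity
    constructor <;> linarith
  · have hnb : -b ≠ 0 := neg_ne_zero.mpr hb
    have h1 : Sal ψ a b = eta (-b) * Sal ψ (a * (-b)) (-1 ^ 2) := by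
      rw [Sal, Sal, Finset.mul_sum]
      refine Finset.sum_nbij' (fun x => (-b)⁻¹ * x) (fun x => -b * x) ?_ ?_ ?_ ?_ ?_
      · intro x hx; simpa [hb] using hx
      · intro x hx; simpa [hb] using hx
      · intro x _; field_simp
      · intro x _; field_simp
      · intro x hx
        have hx0 : x ≠ 0 := (mem_filter.mp hx).2
        rw [← mul_assoc, ← eta_mul, mul_inv_cancel_left₀ hnb]
        congr 2
        field_simp
    rw [h1, norm_mul, eta_norm _ hnb, one_mul]
    apply fin
    rw [Sal_core h2 ψ hψ]
    have h0 : ∑ z : F, ψ (2 * 1 * z) = 0 :=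
      sum_char_mul ψ hψ _ (by simpa using two_ne h2)
    rw [h0, sub_zero, norm_mul, Complex.norm_natCast, mul_comm]
    gcongr
    refine (norm_sum_le _ _).trans ?_
    simp only [AddChar.norm_apply, Finset.sum_const, nsmul_eq_mul, mul_one]
    exact_mod_cast card_sqrt_le (-(a * -b))

lemma mixed_bound (h2 : ringChar F ≠ 2) (hq3 : 3 ≤ Fintype.card F) (ψ : AddChar F ℂ)
    (hψ : ψ ≠ 1) (a b : F) (ha : a ≠ 0) (d : ℕ) :
    ‖open Classical in ∑ x ∈ univ.filter (fun x : F => x ≠ 0),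
      eta x ^ d * ψ (a * x + b * x⁻¹)‖ ≤ 2 * Real.sqrt (Fintype.card F) := by
  classical
  rcases Nat.even_or_odd' d with ⟨e, rfl | rfl⟩
  · have h1 : ∑ x ∈ univ.filter (fun x : F => x ≠ 0),
        eta x ^ (2 * e) * ψ (a * x + b * x⁻¹) = Kl ψ a b := by
      rw [Kl]
      refine Finset.sum_congr rfl fun x hx => ?_
      rw [pow_mul, eta_sq x (mem_filter.mp hx).2, one_pow, one_mul]
    rw [h1]
    by_cases hb : b = 0
    · have h3 : Kl ψ a b = -1 := by
        rw [Kl, hb, Finset.filter_ne', Finset.sum_erase_eq_sub (mem_univ _)]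
        simp only [zero_mul, add_zero, mul_zero, AddChar.map_zero_eq_one]
        rw [sum_char_mul ψ hψ a ha]
        simp
      rw [h3, norm_neg, norm_one]
      have : 1 ≤ Real.sqrt (Fintype.card F) := by
        rw [Real.one_le_sqrt]
        exact_mod_cast (by omega : 1 ≤ Fintype.card F)
      linarith
    · exact weil_kloosterman _ rfl hq3 ψ hψ a b ha hb
  · have h1 : ∑ x ∈ univ.filter (fun x : F => x ≠ 0),
        eta x ^ (2 * e + 1) * ψ (a * x + b * x⁻¹) = Sal ψ a b := by
      rw [Sal]
      refine Finset.sum_congr rfl fun x hx => ?_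
      rw [pow_succ, pow_mul, eta_sq x (mem_filter.mp hx).2, one_pow, one_mul]
    rw [h1]
    exact Sal_bound h2 ψ hψ a b

end SalieSection


noncomputable section FourierSection

variable {F : Type*} [Field F] [Fintype F] {d : ℕ}

lemma addChar_sum {ι : Type*} (ψ : AddChar F ℂ) (S : Finset ι) (f : ι → F) :
    ψ (∑ i ∈ S, f i) = ∏ i ∈ S, ψ (f i) := by
  classical
  induction S using Finset.induction_on with
  | empty => simp
  | insert i S hi ih => rw [Finset.sum_insert hi, Finset.prod_insert hi,
      AddChar.map_add_eq_mul, ih]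

lemma gauss_form (h2 : ringChar F ≠ 2) (ψ : AddChar F ℂ) (hψ : ψ ≠ 1)
    (Q : QuadraticForm F (Fin d → F))
    (hQ : ∀ x, (∀ y, QuadraticMap.polar (⇑Q) x y = 0) → x = 0) :
    ∃ C : ℂ, ‖C‖ = Real.sqrt (Fintype.card F) ^ d ∧
      ∀ s : F, s ≠ 0 → ∑ z : Fin d → F, ψ (s * Q z) = eta s ^ d * C := by
  classical
  let : Invertible (2 : F) := invertibleOfNonzero (two_ne h2)
  have hsep : (QuadraticMap.associated (R := F) Q).SeparatingLeft := by
    intro x hx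
    apply hQ
    intro y
    have h := hx y
    rw [QuadraticMap.associated_apply] at h
    rw [QuadraticMap.polar]
    have h4 : (2 : F) * (⅟2 * (Q (x + y) - Q x - Q y)) = 0 := by
      have h5 : (⅟2 : F) * (Q (x + y) - Q x - Q y) = 0 := h
      rw [h5, mul_zero]
    rwa [mul_invOf_cancel_left'] at h4
  obtain ⟨w, ⟨e⟩⟩ := QuadraticForm.equivalent_weightedSumSquares_units_of_nondegenerate' Q hsep
  have hfr : Module.finrank F (Fin d → F) = d := by simp
  refine ⟨∏ i, (eta ((w i : Fˣ) : F) * gs ψ), ?_, ?_⟩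
  · rw [norm_prod]
    have h4 : ∀ i, ‖eta ((w i : Fˣ) : F) * gs ψ‖ = Real.sqrt (Fintype.card F) := by
      intro i
      rw [norm_mul, eta_norm _ (w i).ne_zero, one_mul, gs_norm h2 ψ hψ]
    rw [Finset.prod_congr rfl fun i _ => h4 i, Finset.prod_const, Finset.card_univ,
      Fintype.card_fin, hfr]
  · intro s hs
    rw [Fintype.sum_equiv e.toLinearEquiv.toEquiv _
      (fun v => ψ (s * QuadraticMap.weightedSumSquares F w v))]
    · have h1 : ∀ v : Fin (Module.finrank F (Fin d → F)) → F,
          ψ (s * QuadraticMap.weightedSumSquares F w v) =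
            ∏ i, ψ ((s * (w i : Fˣ)) * v i ^ 2) := by
        intro v
        rw [QuadraticMap.weightedSumSquares_apply, Finset.mul_sum, addChar_sum]
        refine Finset.prod_congr rfl fun i _ => ?_
        congr 1
        rw [Units.smul_def, smul_eq_mul]
        ring
      rw [Finset.sum_congr rfl fun v _ => h1 v]
      have h3 := Finset.prod_univ_sum (fun _ : Fin (Module.finrank F (Fin d → F)) =>
        (univ : Finset F)) (fun i z => ψ ((s * (w i : Fˣ)) * z ^ 2))
      rw [Fintype.piFinset_univ] at h3
      rw [← h3]
      have h4 : ∀ i, ∑ z : F, ψ ((s * (w i : Fˣ)) * z ^ 2) =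
          eta s * (eta ((w i : Fˣ) : F) * gs ψ) := by
        intro i
        rw [sum_sq h2 ψ hψ _ (mul_ne_zero hs (Units.ne_zero _)), eta_mul, mul_assoc]
      rw [Finset.prod_congr rfl fun i _ => h4 i, Finset.prod_mul_distrib, Finset.prod_const,
        Finset.card_univ, Fintype.card_fin]
      exact congrArg (fun n : ℕ => eta s ^ n * ∏ i, (eta ((w i : Fˣ) : F) * gs ψ)) hfr
    · intro v
      congr 2
      exact (e.map_app v).symm

/-- Fourier transform -/
def ft (ψ : AddChar F ℂ) (Q : QuadraticForm F (Fin d → F)) (f : (Fin d → F) → ℂ)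
    (w : Fin d → F) : ℂ := ∑ x, f x * ψ (QuadraticMap.polarBilin Q x w)

lemma orth (ψ : AddChar F ℂ) (hψ : ψ ≠ 1) (Q : QuadraticForm F (Fin d → F))
    (hQ : ∀ x, (∀ y, QuadraticMap.polar (⇑Q) x y = 0) → x = 0) (z : Fin d → F) :
    ∑ w, ψ (QuadraticMap.polarBilin Q z w) =
      open Classical in if z = 0 then (Fintype.card F : ℂ) ^ d else 0 := by
  classical
  split_ifs with h
  · simp [h]
  · obtain ⟨w0, hw0⟩ : ∃ w, QuadraticMap.polar (⇑Q) z w ≠ 0 := by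
      by_contra! hc
      exact h (hQ z hc)
    let φ : AddChar (Fin d → F) ℂ :=
      ψ.compAddMonoidHom (QuadraticMap.polarBilin Q z).toAddMonoidHom
    have hφ : φ ≠ 1 := by
      intro hc
      apply hψ
      ext r
      have h1 : φ ((r / QuadraticMap.polar (⇑Q) z w0) • w0) = 1 := by rw [hc]; rfl
      have h3 : φ ((r / QuadraticMap.polar (⇑Q) z w0) • w0) = ψ r := by
        change ψ (QuadraticMap.polarBilin Q z _) = _
        rw [map_smul, QuadraticMap.polarBilin_apply_apply, smul_eq_mul,
          div_mul_cancel₀ _ hw0]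
      rw [← h3, h1]
      rfl
    exact AddChar.sum_eq_zero_of_ne_one hφ

lemma plancherel (ψ : AddChar F ℂ) (hψ : ψ ≠ 1) (Q : QuadraticForm F (Fin d → F))
    (hQ : ∀ x, (∀ y, QuadraticMap.polar (⇑Q) x y = 0) → x = 0) (f : (Fin d → F) → ℂ) :
    ∑ w, ‖ft ψ Q f w‖ ^ 2 = (Fintype.card F : ℝ) ^ d * ∑ x, ‖f x‖ ^ 2 := by
  classical
  have key : ∑ w, ft ψ Q f w * (starRingEnd ℂ) (ft ψ Q f w) =
      (Fintype.card F : ℂ) ^ d * ∑ x, f x * (starRingEnd ℂ) (f x) := by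
    simp only [ft, map_sum, Finset.sum_mul_sum, map_mul]
    rw [Finset.sum_comm, Finset.mul_sum]
    refine Finset.sum_congr rfl fun x _ => ?_
    rw [Finset.sum_comm]
    have h1 : ∀ y, ∑ w, f x * ψ (QuadraticMap.polarBilin Q x w) * ((starRingEnd ℂ) (f y) *
        (starRingEnd ℂ) (ψ (QuadraticMap.polarBilin Q y w))) =
        f x * (starRingEnd ℂ) (f y) * (if x - y = 0 then (Fintype.card F : ℂ) ^ d else 0) := by
      intro y
      rw [← orth ψ hψ Q hQ, Finset.mul_sum]
      refine Finset.sum_congr rfl fun w _ => ?_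
      rw [map_sub, LinearMap.sub_apply, sub_eq_add_neg, AddChar.map_add_eq_mul, AddChar.map_neg_eq_conj]
      ring
    rw [Finset.sum_congr rfl fun y _ => h1 y]
    simp only [sub_eq_zero, mul_ite, mul_zero]
    rw [Finset.sum_ite_eq]
    simp
    ring
  simp only [Complex.mul_conj, Complex.normSq_eq_norm_sq] at key
  exact_mod_cast key

/-- normalized sphere indicator -/
def bet (Q : QuadraticForm F (Fin d → F)) (t : F) (z : Fin d → F) : ℝ :=
  (open Classical in if Q z = t then (1 : ℝ) else 0) - 1 / Fintype.card F

lemma bet_eq (ψ : AddChar F ℂ) (hψ : ψ ≠ 1) (Q : QuadraticForm F (Fin d → F)) (t : F)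
    (z : Fin d → F) : (bet Q t z : ℂ) = (1 / Fintype.card F) *
      open Classical in ∑ s ∈ univ.filter (fun x : F => x ≠ 0), ψ (s * (Q z - t)) := by
  classical
  have hprim := AddChar.IsPrimitive.of_ne_one hψ
  have hq0 : (Fintype.card F : ℂ) ≠ 0 := by exact_mod_cast Fintype.card_ne_zero
  rw [Finset.filter_ne', Finset.sum_erase_eq_sub (mem_univ _), AddChar.sum_mulShift _ hprim, bet]
  simp only [sub_eq_zero]
  split_ifs
  · simp [mul_sub, hq0]
  · simp

lemma ft_bet_bound (h2 : ringChar F ≠ 2) (hq3 : 3 ≤ Fintype.card F) (ψ : AddChar F ℂ)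
    (hψ : ψ ≠ 1) (Q : QuadraticForm F (Fin d → F))
    (hQ : ∀ x, (∀ y, QuadraticMap.polar (⇑Q) x y = 0) → x = 0) (t : F) (ht : t ≠ 0)
    (w : Fin d → F) :
    ‖ft ψ Q (fun z => (bet Q t z : ℂ)) w‖ ≤
      2 * Real.sqrt (Fintype.card F) ^ (d + 1) / Fintype.card F := by
  classical
  obtain ⟨C, hC, hG⟩ := gauss_form h2 ψ hψ Q hQ
  have h1 : ft ψ Q (fun z => (bet Q t z : ℂ)) w = (1 / Fintype.card F) * C *
      ∑ s ∈ univ.filter (fun x : F => x ≠ 0), eta s ^ d * ψ ((-t) * s + (-Q w) * s⁻¹) := by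
    simp only [ft, bet_eq ψ hψ]
    simp only [mul_assoc, Finset.sum_mul]
    rw [← Finset.mul_sum, Finset.sum_comm]
    congr 1
    rw [Finset.mul_sum]
    refine Finset.sum_congr rfl fun s hs => ?_
    have hs0 : s ≠ 0 := (mem_filter.mp hs).2
    rw [← mul_assoc, mul_comm C, ← hG s hs0,
      ← Equiv.sum_comp (Equiv.addRight (s⁻¹ • w)) (fun z => ψ (s * Q z)), Finset.sum_mul]
    refine Finset.sum_congr rfl fun z _ => ?_
    rw [← AddChar.map_add_eq_mul, ← AddChar.map_add_eq_mul]
    congr 1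
    simp only [Equiv.coe_addRight, QuadraticMap.polarBilin_apply_apply]
    have h3 : Q (z + s⁻¹ • w) = Q z + s⁻¹ * s⁻¹ * Q w + s⁻¹ * QuadraticMap.polar (⇑Q) z w := by
      have h4 := QuadraticMap.polar_smul_right Q s⁻¹ z w
      have h5 := QuadraticMap.map_smul Q s⁻¹ w
      rw [smul_eq_mul] at h4 h5
      rw [← h4, ← h5, QuadraticMap.polar]
      ring
    rw [h3]
    field_simp
    ring
  rw [h1, norm_mul, norm_mul, hC]
  have h5 := mixed_bound h2 hq3 ψ hψ (-t) (-Q w) (neg_ne_zero.mpr ht) d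
  have h6 : ‖(1 / Fintype.card F : ℂ)‖ = 1 / Fintype.card F := by simp
  rw [h6]
  calc _ ≤ 1 / (Fintype.card F : ℝ) * Real.sqrt (Fintype.card F) ^ d *
        (2 * Real.sqrt (Fintype.card F)) := by gcongr
    _ = _ := by rw [pow_succ]; ring

lemma op_bound (h2 : ringChar F ≠ 2) (hq3 : 3 ≤ Fintype.card F) (Q : QuadraticForm F (Fin d → F))
    (hQ : ∀ x, (∀ y, QuadraticMap.polar (⇑Q) x y = 0) → x = 0) (t : F) (ht : t ≠ 0)
    (f : (Fin d → F) → ℝ) :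
    ∑ x, (∑ y, bet Q t (x - y) * f y) ^ 2 ≤
      (2 * Real.sqrt (Fintype.card F) ^ (d + 1) / Fintype.card F) ^ 2 * ∑ x, f x ^ 2 := by
  classical
  obtain ⟨ψ, hψ⟩ : ∃ ψ : AddChar F ℂ, ψ ≠ 1 := by
    obtain ⟨ψ, hψ⟩ := AddChar.exists_apply_ne_zero.mpr (one_ne_zero (α := F))
    refine ⟨ψ, ?_⟩
    rintro rfl
    exact hψ rfl
  have hconv : ∀ w, ft ψ Q (fun x => ((∑ y, bet Q t (x - y) * f y : ℝ) : ℂ)) w =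
      ft ψ Q (fun z => (bet Q t z : ℂ)) w * ft ψ Q (fun z => (f z : ℂ)) w := by
    intro w
    simp only [ft]
    rw [Finset.sum_mul_sum]
    simp only [Complex.ofReal_sum, Complex.ofReal_mul, Finset.sum_mul]
    rw [Finset.sum_comm]
    conv_rhs => rw [Finset.sum_comm]
    refine Finset.sum_congr rfl fun y _ => ?_
    rw [← Equiv.sum_comp (Equiv.addRight y)]
    refine Finset.sum_congr rfl fun z _ => ?_
    simp only [Equiv.coe_addRight, add_sub_cancel_right, map_add, LinearMap.add_apply,
      AddChar.map_add_eq_mul]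
    ring
  have p1 := plancherel ψ hψ Q hQ (fun x => ((∑ y, bet Q t (x - y) * f y : ℝ) : ℂ))
  have p2 := plancherel ψ hψ Q hQ (fun x => (f x : ℂ))
  simp only [Complex.norm_real, Real.norm_eq_abs, sq_abs] at p1 p2
  have hqd : (0 : ℝ) < (Fintype.card F : ℝ) ^ d :=
    pow_pos (by exact_mod_cast Fintype.card_pos) d
  refine le_of_mul_le_mul_left ?_ hqd
  rw [← p1, mul_left_comm, ← p2, Finset.mul_sum]
  refine Finset.sum_le_sum fun w _ => ?_
  rw [hconv, norm_mul, mul_pow]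
  gcongr
  exact ft_bet_bound h2 hq3 ψ hψ Q hQ t ht w

end FourierSection


noncomputable section PathSection

variable {F : Type*} [Field F] [Fintype F] {d : ℕ}

/-- the l2 norm -/
def nr {V : Type*} [Fintype V] (f : V → ℝ) : ℝ := Real.sqrt (∑ x, f x ^ 2)

lemma nr_nonneg {V : Type*} [Fintype V] (f : V → ℝ) : 0 ≤ nr f := Real.sqrt_nonneg _

lemma nr_eq {V : Type*} [Fintype V] (f : V → ℝ) :
    nr f = ‖(WithLp.toLp 2 f : EuclideanSpace ℝ V)‖ := by
  rw [EuclideanSpace.norm_eq, nr]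
  simp

lemma nr_add {V : Type*} [Fintype V] (f g : V → ℝ) :
    nr (fun x => f x + g x) ≤ nr f + nr g := by
  rw [nr_eq, nr_eq, nr_eq]
  exact norm_add_le (WithLp.toLp 2 f : EuclideanSpace ℝ V) (WithLp.toLp 2 g)

lemma nr_mono {V : Type*} [Fintype V] (f g : V → ℝ) (h : ∀ x, |f x| ≤ |g x|) :
    nr f ≤ nr g := by
  apply Real.sqrt_le_sqrt
  exact Finset.sum_le_sum fun x _ => sq_le_sq.mpr (h x)

lemma nr_smul {V : Type*} [Fintype V] (c : ℝ) (hc : 0 ≤ c) (f : V → ℝ) :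
    nr (fun x => c * f x) = c * nr f := by
  rw [nr, nr]
  simp only [mul_pow]
  rw [← Finset.mul_sum, Real.sqrt_mul (sq_nonneg c), Real.sqrt_sq hc]

/-- indicator of E -/
def ind {V : Type*} (E : Finset V) (x : V) : ℝ := open Classical in if x ∈ E then 1 else 0

lemma ind_sq {V : Type*} (E : Finset V) (x : V) : ind E x ^ 2 = ind E x := by
  rw [ind]; split_ifs <;> simp

lemma ind_mul_self {V : Type*} (E : Finset V) (x : V) : ind E x * ind E x = ind E x := by
  rw [ind]; split_ifs <;> simp

lemma ind_sum {V : Type*} [Fintype V] (E : Finset V) : ∑ x, ind E x = E.card := by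
  classical
  simp [ind]

lemma nr_ind {V : Type*} [Fintype V] (E : Finset V) : nr (ind E) = Real.sqrt E.card := by
  rw [nr]
  simp only [ind_sq, ind_sum]

lemma nr_ind_mul {V : Type*} [Fintype V] (E : Finset V) (f : V → ℝ) :
    nr (fun x => ind E x * f x) ≤ nr f := by
  apply nr_mono
  intro x
  rw [ind]
  split_ifs <;> simp

lemma sum_supp {V : Type*} [Fintype V] (E : Finset V) (g : V → ℝ)
    (hg : ∀ x, g x = ind E x * g x) : |∑ x, g x| ≤ Real.sqrt E.card * nr g := by
  rw [← nr_ind, nr, nr, ← Real.sqrt_mul (Finset.sum_nonneg fun _ _ => sq_nonneg _)]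
  apply Real.abs_le_sqrt
  rw [Finset.sum_congr rfl fun x _ => hg x]
  exact Finset.sum_mul_sq_le_sq_mul_sq univ (ind E) g

/-- number of paths from a given vertex -/
def pf (Q : QuadraticForm F (Fin d → F)) (E : Finset (Fin d → F)) :
    (k : ℕ) → (Fin k → F) → (Fin d → F) → ℝ
  | 0, _, x => ind E x
  | k + 1, t, x => ind E x * ∑ y,
      (open Classical in if Q (x - y) = t 0 then (1 : ℝ) else 0) * pf Q E k (fun i => t i.succ) y

lemma pf_supp (Q : QuadraticForm F (Fin d → F)) (E : Finset (Fin d → F)) (k : ℕ) (t : Fin k → F)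
    (x : Fin d → F) : pf Q E k t x = ind E x * pf Q E k t x := by
  cases k with
  | zero => rw [pf, ind_mul_self]
  | succ k => rw [pf, ← mul_assoc, ind_mul_self]

/-- path indicator -/
def Wt (Q : QuadraticForm F (Fin d → F)) (E : Finset (Fin d → F)) (k : ℕ) (t : Fin k → F)
    (x : Fin (k + 1) → Fin d → F) : ℝ :=
  open Classical in if (∀ i, x i ∈ E) ∧ ∀ i : Fin k, Q (x i.castSucc - x i.succ) = t i
    then 1 else 0

lemma Wt_cons (Q : QuadraticForm F (Fin d → F)) (E : Finset (Fin d → F)) (k : ℕ)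
    (t : Fin (k + 1) → F) (a : Fin d → F) (x : Fin (k + 1) → Fin d → F) :
    Wt Q E (k + 1) t (Fin.cons a x) = ind E a *
      ((open Classical in if Q (a - x 0) = t 0 then (1 : ℝ) else 0) *
        Wt Q E k (fun i => t i.succ) x) := by
  classical
  simp only [Wt, ind]
  have h1 : (∀ i, (Fin.cons a x : Fin (k + 2) → Fin d → F) i ∈ E) ↔ a ∈ E ∧ ∀ i, x i ∈ E := by
    rw [Fin.forall_fin_succ]
    simp
  have h2 : (∀ i : Fin (k + 1), Q ((Fin.cons a x : Fin (k + 2) → Fin d → F) i.castSucc -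
      (Fin.cons a x : Fin (k + 2) → Fin d → F) i.succ) = t i) ↔
      Q (a - x 0) = t 0 ∧ ∀ i : Fin k, Q (x i.castSucc - x i.succ) = t i.succ := by
    rw [Fin.forall_fin_succ]
    simp
  simp only [h1, h2]
  by_cases c1 : a ∈ E <;> by_cases c2 : Q (a - x 0) = t 0 <;> by_cases c3 : ∀ i, x i ∈ E <;>
    simp [c1, c2, c3]

lemma sum_Wt (Q : QuadraticForm F (Fin d → F)) (E : Finset (Fin d → F)) (k : ℕ) :
    ∀ (t : Fin k → F) (h : (Fin d → F) → ℝ),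
    ∑ x : Fin (k + 1) → Fin d → F, h (x 0) * Wt Q E k t x = ∑ y, h y * pf Q E k t y := by
  classical
  induction k with
  | zero =>
    intro t h
    refine Fintype.sum_equiv (Equiv.funUnique (Fin 1) (Fin d → F)) _ _ fun x => ?_
    simp [Wt, pf, ind]
  | succ k ih =>
    intro t h
    rw [← Equiv.sum_comp (Fin.consEquiv (fun _ : Fin (k + 2) => (Fin d → F))),
      Fintype.sum_prod_type]
    refine Finset.sum_congr rfl fun a _ => ?_
    rw [pf, ← ih, Finset.mul_sum, Finset.mul_sum]
    refine Finset.sum_congr rfl fun x _ => ?_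
    change h ((Fin.cons a x : Fin (k + 2) → Fin d → F) 0) * Wt Q E (k + 1) t (Fin.cons a x) = _
    rw [Wt_cons, Fin.cons_zero]

lemma card_eq_sum (Q : QuadraticForm F (Fin d → F)) (E : Finset (Fin d → F)) (k : ℕ)
    (t : Fin k → F) :
    (Nat.card {x : Fin (k + 1) → (Fin d → F) // (∀ i, x i ∈ E) ∧
        ∀ i : Fin k, Q (x i.castSucc - x i.succ) = t i} : ℝ) = ∑ y, pf Q E k t y := by
  classical
  have h := sum_Wt Q E k t (fun _ => 1)
  simp only [one_mul] at h
  rw [← h, Nat.card_eq_fintype_card, Fintype.card_subtype]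
  simp [Wt]

lemma nr_induct (h2 : ringChar F ≠ 2) (hq3 : 3 ≤ Fintype.card F) (Q : QuadraticForm F (Fin d → F))
    (hQ : ∀ x, (∀ y, QuadraticMap.polar (⇑Q) x y = 0) → x = 0) (E : Finset (Fin d → F))
    (μ lam : ℝ) (hμ : μ = E.card / Fintype.card F)
    (hlam : lam = 2 * Real.sqrt (Fintype.card F) ^ (d + 1) / Fintype.card F) (k : ℕ) :
    ∀ t : Fin k → F, (∀ i, t i ≠ 0) →
    nr (fun x => pf Q E k t x - μ ^ k * ind E x) ≤
      Real.sqrt E.card * ((μ + lam) ^ k - μ ^ k) := by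
  classical
  have hμ0 : 0 ≤ μ := by rw [hμ]; positivity
  have hlam0 : 0 ≤ lam := by rw [hlam]; positivity
  have hop : ∀ (s : F), s ≠ 0 → ∀ f : (Fin d → F) → ℝ,
      nr (fun x => ∑ y, bet Q s (x - y) * f y) ≤ lam * nr f := by
    intro s hs f
    have h := op_bound h2 hq3 Q hQ s hs f
    rw [← hlam] at h
    have h3 := Real.sqrt_le_sqrt h
    rwa [Real.sqrt_mul (sq_nonneg _), Real.sqrt_sq hlam0] at h3
  induction k with
  | zero =>
    intro t _
    simp [pf, nr]
  | succ k ih =>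
    intro t ht
    set t' : Fin k → F := fun i => t i.succ with ht'
    have ihk := ih t' (fun i => ht i.succ)
    set g : (Fin d → F) → ℝ := fun x => pf Q E k t' x - μ ^ k * ind E x with hg
    have hgs : ∀ x, g x = ind E x * g x := by
      intro x
      have e1 := pf_supp Q E k t' x
      have e2 := ind_mul_self E x
      simp only [hg]
      linear_combination e1 + (μ ^ k) * e2
    set σ : ℝ := (∑ y, g y) / Fintype.card F with hσ
    have hdec : ∀ x, pf Q E (k + 1) t x - μ ^ (k + 1) * ind E x =
        ind E x * (∑ y, bet Q (t 0) (x - y) * (μ ^ k * ind E y)) +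
        (ind E x * (∑ y, bet Q (t 0) (x - y) * g y) + ind E x * σ) := by
      intro x
      rw [pf]
      have e1 : ∀ y, (if Q (x - y) = t 0 then (1 : ℝ) else 0) * pf Q E k t' y =
          bet Q (t 0) (x - y) * (μ ^ k * ind E y) + bet Q (t 0) (x - y) * g y +
          (μ ^ k * (ind E y) / Fintype.card F + g y / Fintype.card F) := by
        intro y
        simp only [bet, hg]
        ring
      rw [Finset.sum_congr rfl fun y _ => e1 y, Finset.sum_add_distrib, Finset.sum_add_distrib,
        Finset.sum_add_distrib, ← Finset.sum_div, ← Finset.sum_div, ← Finset.mul_sum, ind_sum,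
        ← hσ, pow_succ, hμ]
      ring
    have n1 : nr (fun x => ind E x * (∑ y, bet Q (t 0) (x - y) * (μ ^ k * ind E y))) ≤
        lam * (μ ^ k * Real.sqrt E.card) := by
      refine (nr_ind_mul E _).trans ((hop (t 0) (ht 0) _).trans ?_)
      rw [nr_smul _ (pow_nonneg hμ0 k), nr_ind]
    have n2 : nr (fun x => ind E x * (∑ y, bet Q (t 0) (x - y) * g y)) ≤ lam * nr g :=
      (nr_ind_mul E _).trans (hop (t 0) (ht 0) _)
    have n3 : nr (fun x => ind E x * σ) ≤ μ * nr g := by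
      have e1 : nr (fun x => ind E x * σ) ≤ nr (fun x => |σ| * ind E x) := by
        apply nr_mono
        intro x
        rw [abs_mul, abs_mul, abs_abs, mul_comm]
      rw [nr_smul _ (abs_nonneg _), nr_ind] at e1
      refine e1.trans ?_
      have e2 := sum_supp E g hgs
      have hq0 : (0 : ℝ) < Fintype.card F := by exact_mod_cast Fintype.card_pos
      rw [hσ, abs_div, abs_of_pos hq0, hμ]
      calc |∑ y, g y| / Fintype.card F * Real.sqrt E.card
          ≤ (Real.sqrt E.card * nr g) / Fintype.card F * Real.sqrt E.card :=
            mul_le_mul_of_nonneg_right (div_le_div_of_nonneg_right e2 hq0.le)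
              (Real.sqrt_nonneg _)
        _ = (Real.sqrt E.card * Real.sqrt E.card) / Fintype.card F * nr g := by ring
        _ = _ := by rw [Real.mul_self_sqrt (Nat.cast_nonneg _)]
    rw [funext hdec]
    refine (nr_add _ _).trans ?_
    have n4 := nr_add (fun x => ind E x * (∑ y, bet Q (t 0) (x - y) * g y))
      (fun x => ind E x * σ)
    have n5 : (lam + μ) * nr g ≤ (lam + μ) * (Real.sqrt E.card * ((μ + lam) ^ k - μ ^ k)) :=
      mul_le_mul_of_nonneg_left ihk (by positivity)
    have n6 : Real.sqrt E.card * ((μ + lam) ^ (k + 1) - μ ^ (k + 1)) =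
        lam * (μ ^ k * Real.sqrt E.card) +
        (lam + μ) * (Real.sqrt E.card * ((μ + lam) ^ k - μ ^ k)) := by ring
    linarith

lemma numeric (n R : ℝ) (k : ℕ) (hk : 1 ≤ k) (hR : 0 < R)
    (hn : n > 2 * k / Real.log 2 * R) :
    n * ((n + 2 * R) ^ k - n ^ k) ≤ 2 * k / Real.log 2 * R * n ^ k := by
  have hl : 0 < Real.log 2 := Real.log_pos (by norm_num)
  have hk0 : (0 : ℝ) < k := by exact_mod_cast hk
  have hn0 : 0 < n := lt_trans (by positivity) hn
  set θ : ℝ := 2 * k / Real.log 2 * R / n with hθ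
  have hθ0 : 0 ≤ θ := by positivity
  have hθ1 : θ ≤ 1 := by rw [hθ, div_le_one hn0]; exact hn.le
  have h1 : (1 + 2 * R / n) ^ k ≤ 1 + θ := by
    have a1 : (1 + 2 * R / n) ^ k ≤ Real.exp (2 * R / n) ^ k := by
      gcongr
      rw [add_comm]
      exact Real.add_one_le_exp _
    have a2 : Real.exp (2 * R / n) ^ k = Real.exp (θ * Real.log 2) := by
      rw [← Real.exp_nat_mul, hθ]
      congr 1
      field_simp
    have a3 := convexOn_exp.2 (Set.mem_univ (0 : ℝ)) (Set.mem_univ (Real.log 2))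
      (sub_nonneg.mpr hθ1) hθ0 (by ring)
    simp only [smul_eq_mul, mul_zero, zero_add, Real.exp_zero,
      Real.exp_log (by norm_num : (0 : ℝ) < 2)] at a3
    rw [a2] at a1
    linarith
  have h2 : (n + 2 * R) ^ k = n ^ k * (1 + 2 * R / n) ^ k := by
    rw [← mul_pow]
    congr 1
    field_simp
  have h3 : 2 * k / Real.log 2 * R = n * θ := by rw [hθ]; field_simp
  rw [h2, h3]
  have h4 : 0 ≤ n * n ^ k := by positivity
  nlinarith [mul_le_mul_of_nonneg_left h1 h4]

end PathSection

/-- Counting paths of length `k` with prescribed edge lengths,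
for the distance `φ(x,y) = Q(x-y)` coming from a non-degenerate quadratic form. -/
theorem stmt9 (q d k : ℕ) (hd : 2 ≤ d) (hk : 1 ≤ k)
    (F : Type) [Field F] [Fintype F]
    (hq : Fintype.card F = q) (hodd : Odd q)
    (Q : QuadraticForm F (Fin d → F))
    (hQ : ∀ x, (∀ y, QuadraticMap.polar (⇑Q) x y = 0) → x = 0)
    (E : Finset (Fin d → F))
    (t : Fin k → F) (ht : ∀ i, t i ≠ 0)
    (hE : (E.card : ℝ) > (2 * (k : ℝ) / Real.log 2) * (q : ℝ) ^ (((d : ℝ) + 1) / 2)) :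
    |(Nat.card {x : Fin (k + 1) → (Fin d → F) // (∀ i, x i ∈ E) ∧
        ∀ i : Fin k, Q (x i.castSucc - x i.succ) = t i} : ℝ) -
        (E.card : ℝ) ^ (k + 1) / (q : ℝ) ^ k| ≤
      (2 * (k : ℝ) / Real.log 2) * (q : ℝ) ^ (((d : ℝ) + 1) / 2) *
        (E.card : ℝ) ^ k / (q : ℝ) ^ k := by
  have hq3 : 3 ≤ Fintype.card F := by
    have h1 : 1 < Fintype.card F := Fintype.one_lt_card
    rw [hq] at h1 ⊢
    obtain ⟨r, hr⟩ := hodd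
    omega
  have h2 : ringChar F ≠ 2 := by
    intro h
    have := FiniteField.even_card_of_char_two h
    rw [hq] at this
    obtain ⟨r, hr⟩ := hodd
    omega
  have hq0 : (0 : ℝ) < q := by exact_mod_cast (by omega : 0 < q)
  set R : ℝ := (q : ℝ) ^ (((d : ℝ) + 1) / 2) with hR
  have hRs : R = Real.sqrt q ^ (d + 1) := by
    rw [hR, Real.sqrt_eq_rpow, ← Real.rpow_natCast, ← Real.rpow_mul hq0.le]
    congr 1
    push_cast
    ring
  have hR0 : 0 < R := Real.rpow_pos_of_pos hq0 _
  have hind := nr_induct h2 hq3 Q hQ E (E.card / q) (2 * R / q) (by rw [hq])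
    (by rw [hq, hRs]) k t ht
  rw [card_eq_sum]
  set g : (Fin d → F) → ℝ := fun x => pf Q E k t x - ((E.card : ℝ) / q) ^ k * ind E x with hg
  have hgs : ∀ x, g x = ind E x * g x := by
    intro x
    have e1 := pf_supp Q E k t x
    have e2 := ind_mul_self E x
    simp only [hg]
    linear_combination e1 + (((E.card : ℝ) / q) ^ k) * e2
  have hsum : ∑ y, pf Q E k t y - (E.card : ℝ) ^ (k + 1) / (q : ℝ) ^ k = ∑ y, g y := by
    simp only [hg]
    rw [Finset.sum_sub_distrib, ← Finset.mul_sum, ind_sum, div_pow]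
    ring
  rw [hsum]
  refine (sum_supp E g hgs).trans ((mul_le_mul_of_nonneg_left hind (Real.sqrt_nonneg _)).trans ?_)
  rw [← mul_assoc, Real.mul_self_sqrt (Nat.cast_nonneg _), ← add_div, div_pow, div_pow, ← sub_div,
    ← mul_div_assoc]
  have := numeric E.card R k hk hR0 hE
  gcongr
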